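/- arXiv:2001.02481 — 2 statements merged into one kernel-verified Lean document; each statement's English description precedes it below -/
import Mathlib

section
/- There is a family {F_n} of unsatisfiable 3-CNF formulas with Θ(n) clauses and variables such that, over any field F: (1) F_n has a Nullstellensatz refutation of degree O(n^{1/6}·log n); (2) for every constant ε > 0, F_n has a Nullstellensatz refutation of size O(n^{1+ε}) and degree O(n^{1/3}·log n); and (3) there is a constant K > 0 such that every Nullstellensatz refutation of F_n of degree at most K·n^{1/3} has size at least ⌊n^{1/6}⌋!. -/
open MvPolynomial

/-- A Nullstellensatz certificate (refutation): `∑ i, r i * p i + ∑ j, s j * (X j ^ 2 - X j) = 1`. -/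
def IsNSCert {F σ ι : Type} [Field F] [Fintype σ] [Fintype ι]
    (p r : ι → MvPolynomial σ F) (s : σ → MvPolynomial σ F) : Prop :=
  ∑ i, r i * p i + ∑ j, s j * (X j ^ 2 - X j) = 1

/-- The size of a Nullstellensatz refutation:
`∑ i, m(r i) * m(p i) + ∑ j, 2 * m(s j)` where `m` counts monomials. -/
noncomputable def nsSize {F σ ι : Type} [Field F] [Fintype σ] [Fintype ι]
    (p r : ι → MvPolynomial σ F) (s : σ → MvPolynomial σ F) : ℕ :=
  ∑ i, (r i).support.card * (p i).support.card + ∑ j, 2 * (s j).support.card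

/-- The degree of a Nullstellensatz refutation: the maximum of the degrees of the
polynomials `r i * p i` and `s j * (X j ^ 2 - X j)`. -/
noncomputable def nsDegree {F σ ι : Type} [Field F] [Fintype σ] [Fintype ι]
    (p r : ι → MvPolynomial σ F) (s : σ → MvPolynomial σ F) : ℕ :=
  max (Finset.univ.sup fun i => (r i * p i).totalDegree)
    (Finset.univ.sup fun j => (s j * (X j ^ 2 - X j)).totalDegree)

/-- A clause over `n` Boolean variables, given by its sets of positive and negative literals. -/
abbrev Clause (n : ℕ) := Finset (Fin n) × Finset (Fin n)

/-- A CNF formula: a number of variables together with a set of clauses. -/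
structure CNF where
  nvars : ℕ
  clauses : Finset (Clause nvars)

/-- A 3-CNF formula: every clause has at most 3 literals. -/
def CNF.Is3CNF (φ : CNF) : Prop := ∀ C ∈ φ.clauses, C.1.card + C.2.card ≤ 3

/-- Satisfaction of a clause by a Boolean assignment. -/
def Clause.Sat {n : ℕ} (a : Fin n → Bool) (C : Clause n) : Prop :=
  (∃ x ∈ C.1, a x = true) ∨ (∃ y ∈ C.2, a y = false)

/-- Unsatisfiability of a CNF formula. -/
def CNF.Unsat (φ : CNF) : Prop :=
  ∀ a : Fin φ.nvars → Bool, ∃ C ∈ φ.clauses, ¬ Clause.Sat a C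

/-- The polynomial translation `∏_{x ∈ P}(1 - x) * ∏_{y ∈ N} y` of a clause. -/
noncomputable def Clause.poly (F : Type) [Field F] {n : ℕ} (C : Clause n) :
    MvPolynomial (Fin n) F :=
  (∏ x ∈ C.1, (1 - X x)) * ∏ y ∈ C.2, X y

/-- The family of polynomial translations of the clauses of a CNF formula. -/
noncomputable def CNF.polys (F : Type) [Field F] (φ : CNF) :
    {C // C ∈ φ.clauses} → MvPolynomial (Fin φ.nvars) F :=
  fun C => Clause.poly F C.1

/-! ### Reversible-pebbling style derivations -/

/-- The multilinear monomial of a set of variables. -/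
noncomputable def xs (F : Type) [Field F] {N : ℕ} (P : Finset (Fin N)) : MvPolynomial (Fin N) F :=
  ∏ v ∈ P, X v

lemma xs_eq_monomial (F : Type) [Field F] {N : ℕ} (P : Finset (Fin N)) :
    xs F P = monomial (∑ v ∈ P, Finsupp.single v 1) 1 := by
  classical
  unfold xs
  rw [MvPolynomial.monomial_sum_one]
  rfl

lemma xs_support_card (F : Type) [Field F] {N : ℕ} (P : Finset (Fin N)) :
    (xs F P).support.card ≤ 1 := by
  classical
  rw [xs_eq_monomial]
  exact (Finset.card_le_card support_monomial_subset).trans (by simp)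

lemma xs_totalDegree (F : Type) [Field F] {N : ℕ} (P : Finset (Fin N)) :
    (xs F P).totalDegree ≤ P.card := by
  unfold xs
  refine (totalDegree_finsetProd _ _).trans ?_
  refine (Finset.sum_le_card_nsmul P _ 1 ?_).trans (by simp)
  intro i _
  simp

/-- `P` can be turned into `Q` in `t` steps and degree `d`. -/
def Der (F : Type) [Field F] (φ : CNF) (P Q : Finset (Fin φ.nvars)) (t d : ℕ) : Prop :=
  ∃ r : {C // C ∈ φ.clauses} → MvPolynomial (Fin φ.nvars) F,
    xs F P - xs F Q = ∑ C, r C * φ.polys F C ∧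
    ∑ C, (r C).support.card ≤ t ∧ ∀ C, (r C * φ.polys F C).totalDegree ≤ d

section Der
variable {F : Type} [Field F] {φ : CNF}

lemma Der.refl (P : Finset (Fin φ.nvars)) (t d : ℕ) : Der F φ P P t d :=
  ⟨0, by simp, by simp, by simp⟩

lemma Der.mono {P Q : Finset (Fin φ.nvars)} {t d t' d' : ℕ} (h : Der F φ P Q t d)
    (ht : t ≤ t') (hd : d ≤ d') : Der F φ P Q t' d' := by
  obtain ⟨r, h1, h2, h3⟩ := h
  exact ⟨r, h1, h2.trans ht, fun C => (h3 C).trans hd⟩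

lemma Der.symm {P Q : Finset (Fin φ.nvars)} {t d : ℕ} (h : Der F φ P Q t d) :
    Der F φ Q P t d := by
  obtain ⟨r, h1, h2, h3⟩ := h
  refine ⟨-r, ?_, ?_, ?_⟩
  · simp only [Pi.neg_apply, neg_mul, Finset.sum_neg_distrib, ← h1]; ring
  · simpa using h2
  · intro C; simpa using h3 C

lemma Der.trans {P Q R : Finset (Fin φ.nvars)} {t t' d : ℕ} (h : Der F φ P Q t d)
    (h' : Der F φ Q R t' d) : Der F φ P R (t + t') d := by
  classical
  obtain ⟨r, h1, h2, h3⟩ := h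
  obtain ⟨r', h1', h2', h3'⟩ := h'
  refine ⟨r + r', ?_, ?_, ?_⟩
  · simp only [Pi.add_apply, add_mul, Finset.sum_add_distrib, ← h1, ← h1']; ring
  · refine le_trans ?_ (Nat.add_le_add h2 h2')
    rw [← Finset.sum_add_distrib]
    refine Finset.sum_le_sum fun C _ => ?_
    exact (Finset.card_le_card support_add).trans (Finset.card_union_le _ _)
  · intro C
    rw [Pi.add_apply, add_mul]
    exact (totalDegree_add _ _).trans (max_le (h3 C) (h3' C))

lemma Der.step {P S : Finset (Fin φ.nvars)} {v : Fin φ.nvars} {t d : ℕ}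
    (hC : (({v}, S) : Clause φ.nvars) ∈ φ.clauses) (hS : S ⊆ P) (hd : P.card + 1 ≤ d)
    (ht : 1 ≤ t) : Der F φ P (P ∪ {v}) t d := by
  classical
  by_cases hv : v ∈ P
  · rw [Finset.union_eq_left.2 (by simpa using hv)]; exact Der.refl _ _ _
  have key : xs F (P \ S) * Clause.poly F (({v}, S) : Clause φ.nvars) = xs F P * (1 - X v) := by
    unfold Clause.poly xs
    rw [← Finset.prod_sdiff hS, Finset.prod_singleton]; ring
  have key2 : xs F P * (1 - X v) = xs F P - xs F (P ∪ {v}) := by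
    unfold xs
    rw [Finset.prod_union (by simpa using hv), Finset.prod_singleton]; ring
  refine ⟨Pi.single ⟨_, hC⟩ (xs F (P \ S)), ?_, ?_, ?_⟩
  · rw [Finset.sum_eq_single (⟨_, hC⟩ : {C // C ∈ φ.clauses})]
    · rw [Pi.single_eq_same, ← key2, ← key]; rfl
    · intro b _ hb; simp [Pi.single_eq_of_ne hb]
    · simp
  · rw [Finset.sum_eq_single (⟨_, hC⟩ : {C // C ∈ φ.clauses})]
    · rw [Pi.single_eq_same]; exact (xs_support_card F _).trans ht
    · intro b _ hb; simp [Pi.single_eq_of_ne hb]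
    · simp
  · intro C
    by_cases h : C = ⟨_, hC⟩
    · subst h
      rw [Pi.single_eq_same]
      have : CNF.polys F φ ⟨_, hC⟩ = Clause.poly F (({v}, S) : Clause φ.nvars) := rfl
      rw [this, key]
      refine le_trans (totalDegree_mul _ _) (le_trans (Nat.add_le_add (xs_totalDegree F P) ?_) hd)
      refine (totalDegree_sub _ _).trans ?_
      simp
    · simp [Pi.single_eq_of_ne h]

lemma poly_support_card {N : ℕ} (C : Clause N) (h : C.1.card ≤ 1) :
    (Clause.poly F C).support.card ≤ 2 := by
  classical
  obtain ⟨A, S⟩ := C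
  have h0 : Clause.poly F ((∅, S) : Clause N) = xs F S := by simp [Clause.poly, xs]
  by_cases hA : A = ∅
  · subst hA; rw [h0]; exact (xs_support_card F _).trans (by norm_num)
  · have : ∃ v, A = {v} := by
      have : A.card = 1 := le_antisymm (by assumption) (Finset.card_pos.2 (Finset.nonempty_iff_ne_empty.2 hA))
      exact Finset.card_eq_one.1 this
    obtain ⟨v, rfl⟩ := this
    have : Clause.poly F (({v}, S) : Clause N) = xs F S - X v * xs F S := by
      simp [Clause.poly, xs]; ring
    rw [this]
    refine (Finset.card_le_card (support_sub _ _ _)).trans ((Finset.card_union_le _ _).trans ?_)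
    have h1 := xs_support_card F S
    have h2 : (X v * xs F S).support.card ≤ 1 := by
      rw [xs_eq_monomial, X, monomial_mul]
      exact (Finset.card_le_card support_monomial_subset).trans (by simp)
    omega

lemma Der.cert {Q : Finset (Fin φ.nvars)} {z : Fin φ.nvars} {t d : ℕ}
    (h : Der F φ ∅ Q t d) (hz : z ∈ Q) (hC : ((∅, {z}) : Clause φ.nvars) ∈ φ.clauses)
    (hQ : Q.card ≤ d) (h1 : ∀ C ∈ φ.clauses, C.1.card ≤ 1) :
    ∃ r s, IsNSCert (φ.polys F) r s ∧ nsSize (φ.polys F) r s ≤ 2 * (t + 1) ∧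
      nsDegree (φ.polys F) r s ≤ d := by
  classical
  have key : xs F (Q.erase z) * Clause.poly F ((∅, {z}) : Clause φ.nvars) = xs F Q := by
    unfold Clause.poly xs
    rw [← Finset.mul_prod_erase Q _ hz]; simp [mul_comm]
  have hp : CNF.polys F φ ⟨_, hC⟩ = Clause.poly F ((∅, {z}) : Clause φ.nvars) := rfl
  obtain ⟨r, e1, e2, e3⟩ := h
  set u : {C // C ∈ φ.clauses} → MvPolynomial (Fin φ.nvars) F :=
    Pi.single ⟨_, hC⟩ (xs F (Q.erase z)) with hu
  have hsum : ∑ C, u C * φ.polys F C = xs F Q := by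
    rw [Finset.sum_eq_single (⟨_, hC⟩ : {C // C ∈ φ.clauses})]
    · rw [hu, Pi.single_eq_same, hp, key]
    · intro b _ hb; simp [hu, Pi.single_eq_of_ne hb]
    · simp
  have hcard : ∑ C, (u C).support.card ≤ 1 := by
    rw [Finset.sum_eq_single (⟨_, hC⟩ : {C // C ∈ φ.clauses})]
    · rw [hu, Pi.single_eq_same]; exact xs_support_card F _
    · intro b _ hb; simp [hu, Pi.single_eq_of_ne hb]
    · simp
  refine ⟨r + u, 0, ?_, ?_, ?_⟩
  · unfold IsNSCert
    simp only [Pi.add_apply, add_mul, Finset.sum_add_distrib, ← e1, hsum]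
    simp [xs]
  · unfold nsSize
    have : ∑ C, ((r + u) C).support.card * (φ.polys F C).support.card
        ≤ ∑ C, ((r C).support.card + (u C).support.card) * 2 := by
      refine Finset.sum_le_sum fun C _ => Nat.mul_le_mul ?_ (poly_support_card _ (h1 _ C.2))
      exact (Finset.card_le_card support_add).trans (Finset.card_union_le _ _)
    rw [← Finset.sum_mul, Finset.sum_add_distrib] at this
    simp only [Pi.zero_apply, support_zero, Finset.card_empty, mul_zero, Finset.sum_const_zero]
    omega
  · unfold nsDegree
    refine max_le (Finset.sup_le fun C _ => ?_) (by simp)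
    rw [Pi.add_apply, add_mul]
    refine (totalDegree_add _ _).trans (max_le (e3 C) ?_)
    by_cases h : C = ⟨_, hC⟩
    · subst h
      rw [hu, Pi.single_eq_same, hp, key]
      exact (xs_totalDegree F Q).trans hQ
    · simp [hu, Pi.single_eq_of_ne h]

/-- Given that `A` is pebbled, `Q` can be added in `t` steps using `e` extra pebbles. -/
def Adds (F : Type) [Field F] (φ : CNF) (A Q : Finset (Fin φ.nvars)) (t e : ℕ) : Prop :=
  ∀ P, A ⊆ P → Der F φ P (P ∪ Q) t (P.card + e)

lemma Adds.mono {A A' Q : Finset (Fin φ.nvars)} {t e t' e' : ℕ} (h : Adds F φ A Q t e)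
    (hA : A ⊆ A') (ht : t ≤ t') (he : e ≤ e') : Adds F φ A' Q t' e' :=
  fun P hP => (h P (hA.trans hP)).mono ht (by omega)

/-- Compute an intermediate result, use it, uncompute it. -/
lemma Adds.via {A M Q : Finset (Fin φ.nvars)} {t t' e e' w : ℕ} (h : Adds F φ A M t e)
    (h' : Adds F φ (A ∪ M) Q t' e') (hM : M.card ≤ w) (hQ : Q.card ≤ w) :
    Adds F φ A Q (t + t' + t) (w + max e e') := by
  classical
  intro P hP
  have a1 := h P hP
  have a2 := h' (P ∪ M) (Finset.union_subset_union hP (le_refl _))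
  have a3 := (h (P ∪ Q) (hP.trans Finset.subset_union_left)).symm
  rw [show P ∪ Q ∪ M = P ∪ M ∪ Q by rw [Finset.union_right_comm]] at a3
  have c1 := Finset.card_union_le P M
  have c2 := Finset.card_union_le P Q
  have m1 := le_max_left e e'
  have m2 := le_max_right e e'
  refine Der.trans (Der.trans (a1.mono (le_refl _) ?_) (a2.mono (le_refl _) ?_))
    (a3.mono (le_refl _) ?_) <;> omega

/-- Bennett's reversible simulation. -/
lemma bennett {S : Finset (Fin φ.nvars)} {A : ℕ → Finset (Fin φ.nvars)} {t e w k B : ℕ}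
    (hk : 1 ≤ k) (hw : ∀ i, (A i).card ≤ w)
    (h : ∀ i, i < B → Adds F φ (A i ∪ S) (A (i + 1)) t e) (m : ℕ) :
    ∀ a N, 1 ≤ N → N ≤ k ^ m → a + N ≤ B →
      Adds F φ (A a ∪ S) (A (a + N)) ((2 * k - 1) ^ m * t) (e + m * (k - 1) * w) := by
  classical
  induction m with
  | zero =>
    intro a N h1 h2 h3
    have : N = 1 := by simp at h2; omega
    subst this
    simpa using h a (by omega)
  | succ m ih =>
    have sub : ∀ c a N, 1 ≤ N → N ≤ (c + 1) * k ^ m → a + N ≤ B →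
        Adds F φ (A a ∪ S) (A (a + N)) ((2 * c + 1) * ((2 * k - 1) ^ m * t))
          (e + m * (k - 1) * w + c * w) := by
      intro c
      induction c with
      | zero =>
        intro a N h1 h2 h3
        simpa using ih a N h1 (by simpa using h2) h3
      | succ c ihc =>
        intro a N h1 h2 h3
        by_cases hN : N ≤ k ^ m
        · refine (ih a N h1 hN h3).mono (le_refl _) ?_ (by omega)
          exact Nat.le_mul_of_pos_left _ (by omega)
        · have hp : 1 ≤ k ^ m := Nat.one_le_pow _ _ hk
          have b1 := ih a (k ^ m) hp (le_refl _) (by omega)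
          have b2 := ihc (a + k ^ m) (N - k ^ m) (by omega) (by
            rw [add_mul _ 1] at h2; omega) (by omega)
          rw [show a + k ^ m + (N - k ^ m) = a + N by omega] at b2
          have b3 : Adds F φ (A a ∪ S ∪ A (a + k ^ m)) (A (a + N)) _ _ :=
            b2.mono (A' := A a ∪ S ∪ A (a + k ^ m)) (by
              intro x hx
              simp only [Finset.mem_union] at hx ⊢
              tauto) (le_refl _) (le_refl _)
          refine (Adds.via b1 b3 (hw _) (hw _)).mono (le_refl _) ?_ ?_
          · apply le_of_eq; ring
          · rw [max_eq_right (by omega)]; apply le_of_eq; ring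
    intro a N h1 h2 h3
    have := sub (k - 1) a N h1 (by rw [Nat.sub_add_cancel hk, ← pow_succ']; exact h2) h3
    refine this.mono (le_refl _) ?_ ?_
    · rw [show 2 * (k - 1) + 1 = 2 * k - 1 by omega, pow_succ']; apply le_of_eq; ring
    · apply le_of_eq; ring

/-- Adding many singletons one after the other. -/
lemma adds_many {S : Finset (Fin φ.nvars)} {f : ℕ → Fin φ.nvars} {t e : ℕ} (w : ℕ)
    (h : ∀ j, j < w → Adds F φ S {f j} t e) :
    Adds F φ S ((Finset.range w).image f) (w * t) (w + e) := by
  classical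
  induction w with
  | zero => intro P _; simpa using Der.refl _ _ _
  | succ w ih =>
    intro P hP
    have a1 := ih (fun j hj => h j (by omega)) P hP
    have a2 := h w (by omega) (P ∪ (Finset.range w).image f) (hP.trans Finset.subset_union_left)
    have c1 := Finset.card_union_le P ((Finset.range w).image f)
    have c2 : ((Finset.range w).image f).card ≤ w := Finset.card_image_le.trans (by simp)
    rw [Finset.union_assoc, Finset.union_comm ((Finset.range w).image f) {f w},
      ← Finset.insert_eq, ← Finset.image_insert, ← Finset.range_add_one] at a2
    refine (Der.trans (a1.mono (le_refl _) ?_) (a2.mono (le_refl _) ?_)).mono ?_ (le_refl _)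
    · omega
    · omega
    · rw [add_mul, one_mul]
end Der

/-! ### From refutations to pebblings -/

lemma poly_ne_zero {F : Type} [Field F] {N : ℕ} (C : Clause N) : Clause.poly F C ≠ 0 := by
  unfold Clause.poly
  refine mul_ne_zero (Finset.prod_ne_zero_iff.2 fun x _ h => ?_)
    (Finset.prod_ne_zero_iff.2 fun y _ => X_ne_zero y)
  have := congrArg (MvPolynomial.eval (fun _ => (0 : F))) h
  simp at this

lemma exists_walk {F : Type} [Field F] {φ : CNF} (pred : Fin φ.nvars → Finset (Fin φ.nvars))
    (z : Fin φ.nvars) (hcl : ∀ C ∈ φ.clauses, C = (∅, {z}) ∨ ∃ v, C = ({v}, pred v))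
    (hpred : ∀ v, (pred v).card ≤ 2)
    {r : {C // C ∈ φ.clauses} → MvPolynomial (Fin φ.nvars) F}
    {s : Fin φ.nvars → MvPolynomial (Fin φ.nvars) F} (h : IsNSCert (φ.polys F) r s) :
    ∃ (c : ℕ → Finset (Fin φ.nvars)) (T : ℕ), c 0 = ∅ ∧ z ∈ c T ∧
      (∀ t v, v ∉ c t → v ∈ c (t + 1) → pred v ⊆ c t) ∧
      (∀ t, (c t).card ≤ nsDegree (φ.polys F) r s + 3) ∧ T ≤ nsSize (φ.polys F) r s := by
  classical
  set E : Finset (Sym2 (Finset (Fin φ.nvars))) :=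
    Finset.univ.biUnion fun C : {C // C ∈ φ.clauses} => (r C).support.image fun m =>
      s(m.support ∪ C.1.2, m.support ∪ C.1.2 ∪ C.1.1) with hE
  have hEcard : E.card ≤ nsSize (φ.polys F) r s := by
    unfold nsSize
    refine le_trans ?_ (Nat.le_add_right _ _)
    refine Finset.card_biUnion_le.trans (Finset.sum_le_sum fun C _ => ?_)
    refine Finset.card_image_le.trans (Nat.le_mul_of_pos_right _ ?_)
    refine Finset.card_pos.2 (Finset.nonempty_iff_ne_empty.2 fun h0 => ?_)
    exact poly_ne_zero (F := F) C.1 (support_eq_empty.1 h0)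
  set G : SimpleGraph (Finset (Fin φ.nvars)) := SimpleGraph.fromEdgeSet (E : Set _) with hG
  -- properties of edges
  have hadj : ∀ A B, G.Adj A B →
      (∀ v, v ∉ A → v ∈ B → pred v ⊆ A) ∧ B.card ≤ nsDegree (φ.polys F) r s + 3 := by
    intro A B hAB
    rw [hG, SimpleGraph.fromEdgeSet_adj] at hAB
    obtain ⟨hmem, hne⟩ := hAB
    rw [Finset.mem_coe, hE] at hmem
    simp only [Finset.mem_biUnion, Finset.mem_univ, true_and, Finset.mem_image] at hmem
    obtain ⟨C, m, hm, hs⟩ := hmem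
    have hdeg : m.support.card ≤ nsDegree (φ.polys F) r s := by
      have h1 : (r C).totalDegree ≤ (r C * φ.polys F C).totalDegree := by
        rw [totalDegree_mul_of_isDomain]
        · exact Nat.le_add_right _ _
        · rintro h0; rw [h0] at hm; simp at hm
        · exact poly_ne_zero _
      have h2 : (r C * φ.polys F C).totalDegree ≤ nsDegree (φ.polys F) r s :=
        (Finset.le_sup (f := fun i => (r i * φ.polys F i).totalDegree)
          (Finset.mem_univ C)).trans (le_max_left _ _)
      refine le_trans ?_ (h1.trans h2)
      refine le_trans ?_ (le_totalDegree hm)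
      rw [Finsupp.sum, Finset.card_eq_sum_ones]
      refine Finset.sum_le_sum fun i hi => ?_
      exact Nat.one_le_iff_ne_zero.2 (Finsupp.mem_support_iff.1 hi)
    rcases hcl C.1 C.2 with hC | ⟨v, hC⟩
    · rw [hC] at hs
      simp only [Finset.union_empty] at hs
      exfalso
      rcases Sym2.eq_iff.1 hs with ⟨h1, h2⟩ | ⟨h1, h2⟩
      · exact hne (h1.symm.trans h2)
      · exact hne (h2.symm.trans h1)
    · rw [hC] at hs
      simp only at hs
      have c1 := Finset.card_union_le m.support (pred v)
      have c2 := Finset.card_union_le (m.support ∪ pred v) {v}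
      have c3 := hpred v
      simp only [Finset.card_singleton] at c2
      rcases Sym2.eq_iff.1 hs with ⟨h1, h2⟩ | ⟨h1, h2⟩
      · subst h1; subst h2
        refine ⟨fun u hu hu' => ?_, by omega⟩
        have : u = v := by
          rw [Finset.mem_union] at hu'
          rcases hu' with h | h
          · exact absurd h hu
          · simpa using h
        subst this
        exact Finset.subset_union_right
      · subst h1; subst h2
        refine ⟨fun u hu hu' => absurd (Finset.mem_union_left _ hu') hu, by omega⟩
  by_cases hreach : ∃ B, z ∈ B ∧ G.Reachable ∅ B
  · obtain ⟨B, hzB, ⟨p0⟩⟩ := hreach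
    set p := p0.toPath with hp
    have hlen : p.1.length ≤ E.card := by
      have ht : p.1.IsTrail := p.2.isTrail
      rw [← SimpleGraph.Walk.length_edges, ← List.toFinset_card_of_nodup ht.edges_nodup]
      refine Finset.card_le_card fun e he => ?_
      have := SimpleGraph.Walk.edges_subset_edgeSet p.1 (List.mem_toFinset.1 he)
      rw [hG, SimpleGraph.edgeSet_fromEdgeSet] at this
      exact this.1
    refine ⟨p.1.getVert, p.1.length, by simp, by simpa using hzB, ?_, ?_, hlen.trans hEcard⟩
    · intro t v h1 h2
      by_cases ht : t < p.1.length
      · exact (hadj _ _ (p.1.adj_getVert_succ ht)).1 v h1 h2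
      · rw [p.1.getVert_of_length_le (by omega)] at h1
        rw [p.1.getVert_of_length_le (by omega)] at h2
        exact absurd h2 h1
    · have hall : ∀ t, t ≤ p.1.length →
          (p.1.getVert t).card ≤ nsDegree (φ.polys F) r s + 3 := by
        intro t ht
        cases t with
        | zero => simp
        | succ t => exact (hadj _ _ (p.1.adj_getVert_succ (by omega))).2
      intro t
      by_cases ht : t ≤ p.1.length
      · exact hall t ht
      · have := hall _ (le_refl p.1.length)
        rw [p.1.getVert_of_length_le (by omega)]
        simpa using this
  · exfalso
    set f : (Fin φ.nvars →₀ ℕ) → F := fun m => if G.Reachable ∅ m.support then 1 else 0 with hf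
    set Λ : MvPolynomial (Fin φ.nvars) F →ₗ[F] F := (basisMonomials (Fin φ.nvars) F).constr F f
      with hΛ
    have hmon : ∀ m a, Λ (monomial m a) = a * f m := by
      intro m a
      have h1 : Λ (monomial m 1) = f m := by
        have := (basisMonomials (Fin φ.nvars) F).constr_basis F f m
        rwa [coe_basisMonomials] at this
      have h2 : (monomial m a : MvPolynomial (Fin φ.nvars) F) = a • monomial m 1 := by
        rw [smul_monomial, smul_eq_mul, mul_one]
      rw [h2, map_smul, h1, smul_eq_mul]
    -- reduction to monomials
    have hred : ∀ (q p : MvPolynomial (Fin φ.nvars) F),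
        (∀ m ∈ q.support, ∀ a, Λ (monomial m a * p) = 0) → Λ (q * p) = 0 := by
      intro q p hq
      conv_lhs => rw [q.as_sum]
      rw [Finset.sum_mul, map_sum]
      exact Finset.sum_eq_zero fun m hm => hq m hm _
    have hsupp : ∀ (m : Fin φ.nvars →₀ ℕ) (S : Finset (Fin φ.nvars)),
        (m + ∑ v ∈ S, Finsupp.single v 1).support = m.support ∪ S := by
      intro m S
      ext x
      simp only [Finsupp.mem_support_iff, Finsupp.add_apply, Finset.mem_union,
        Finsupp.finsetSum_apply, Finsupp.single_apply, Finset.sum_ite_eq']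
      by_cases hx : x ∈ S <;> simp [hx]
    have hmonS : ∀ m a (S : Finset (Fin φ.nvars)), Λ (monomial m a * xs F S) =
        a * if G.Reachable ∅ (m.support ∪ S) then 1 else 0 := by
      intro m a S
      rw [xs_eq_monomial, monomial_mul, hmon, mul_one, hf]
      simp only [hsupp]
    have hB : ∀ j, Λ (s j * (X j ^ 2 - X j)) = 0 := by
      intro j
      refine hred _ _ fun m _ a => ?_
      have e1 : (X j : MvPolynomial (Fin φ.nvars) F) = xs F {j} := by simp [xs]
      rw [mul_sub, pow_two, ← mul_assoc, map_sub]
      have e2 : (monomial m a : MvPolynomial (Fin φ.nvars) F) * X j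
          = monomial (m + Finsupp.single j 1) a := by
        rw [X, monomial_mul, mul_one]
      have e3 : (m + Finsupp.single j 1).support = m.support ∪ {j} := by
        simpa using hsupp m {j}
      rw [e2, e1, hmonS, hmon, hf]
      simp only [e3, Finset.union_assoc, Finset.union_self]
      ring
    have hP : ∀ C, Λ (r C * φ.polys F C) = 0 := by
      intro C
      refine hred _ _ fun m hm a => ?_
      rcases hcl C.1 C.2 with hC | ⟨v, hC⟩
      · have : φ.polys F C = xs F {z} := by
          unfold CNF.polys; rw [hC]; simp [Clause.poly, xs]
        rw [this, hmonS, if_neg, mul_zero]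
        intro hr
        exact hreach ⟨_, by simp, hr⟩
      · have e : φ.polys F C = xs F (pred v) - X v * xs F (pred v) := by
          unfold CNF.polys; rw [hC]; simp [Clause.poly, xs]; ring
        have e2 : (monomial m a : MvPolynomial (Fin φ.nvars) F) * X v
          = monomial (m + Finsupp.single v 1) a := by
          rw [X, monomial_mul, mul_one]
        have e3 : (m + Finsupp.single v 1).support = m.support ∪ {v} := by
          simpa using hsupp m {v}
        rw [e, mul_sub, ← mul_assoc, map_sub, e2, hmonS, hmonS, e3, Finset.union_right_comm]
        have hiff : G.Reachable ∅ (m.support ∪ pred v) ↔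
            G.Reachable ∅ (m.support ∪ pred v ∪ {v}) := by
          by_cases heq : m.support ∪ pred v = m.support ∪ pred v ∪ {v}
          · rw [← heq]
          · have ha : G.Adj (m.support ∪ pred v) (m.support ∪ pred v ∪ {v}) := by
              rw [hG, SimpleGraph.fromEdgeSet_adj]
              refine ⟨?_, heq⟩
              rw [Finset.mem_coe, hE]
              simp only [Finset.mem_biUnion, Finset.mem_univ, true_and, Finset.mem_image]
              exact ⟨C, m, hm, by rw [hC]⟩
            exact ⟨fun h => h.trans ha.reachable, fun h => h.trans ha.symm.reachable⟩
        simp only [hiff, sub_self]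
    have h1 : Λ 1 = 1 := by
      have := hmon 0 1
      simpa [hf] using this
    unfold IsNSCert at h
    have := congrArg Λ h
    rw [map_add, map_sum, map_sum, Finset.sum_eq_zero (fun C _ => hP C),
      Finset.sum_eq_zero (fun j _ => hB j), h1] at this
    simp at this

/-! ### The time lower bound -/

section LB
variable {V : Type} [DecidableEq V] {v : ℕ → ℕ → ℕ → V} {pred : V → Finset V} {R w q s : ℕ}
  {c : ℕ → Finset V}

lemma traverse
    (hleg : ∀ t u, u ∉ c t → u ∈ c (t + 1) → pred u ⊆ c t)
    (hcard : ∀ t, (c t).card ≤ s) (hw : 2 * s + 1 ≤ w)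
    (hp1 : ∀ i j k, i < R → j < w → k + 1 < q * w → v i j k ∈ pred (v i j (k + 1)))
    (hp2 : ∀ i j k, i + 1 < R → j < w → k < q * w →
      v i (k % w) (q * w - 1) ∈ pred (v (i + 1) j k))
    (hinj : ∀ i j k j' k', i < R → j < w → k < q * w → j' < w → k' < q * w →
      v i j k = v i j' k' → j = j') (hq : 1 ≤ q)
    (i : ℕ) (hi : i + 1 < R) (D : ℕ)
    (ih : ∀ a b (J : Finset ℕ), a ≤ b → s < J.card → (∀ j ∈ J, j < w) →
      (∀ j ∈ J, v i j (q * w - 1) ∉ c a ∧ ∃ t, a ≤ t ∧ t ≤ b ∧ v i j (q * w - 1) ∈ c t) →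
      a + D ≤ b)
    (a b j : ℕ) (hj : j < w) (hemp : ∀ k < q * w, v (i + 1) j k ∉ c a)
    (ht : a ≤ b ∧ v (i + 1) j (q * w - 1) ∈ c b) : a + q * D ≤ b := by
  classical
  have hL : 1 ≤ q * w := Nat.mul_pos hq (by omega)
  -- existence of pebbling moves
  have hfirst : ∀ k t, k < q * w → a ≤ t → v (i + 1) j k ∈ c t →
      ∃ σ, a ≤ σ ∧ σ < t ∧ v (i + 1) j k ∉ c σ ∧ v (i + 1) j k ∈ c (σ + 1) := by
    intro k t hk hat hm
    induction t, hat using Nat.le_induction with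
    | base => exact absurd hm (hemp k hk)
    | succ t hat iht =>
      by_cases hm' : v (i + 1) j k ∈ c t
      · obtain ⟨σ, h1, h2, h3⟩ := iht hm'
        exact ⟨σ, h1, by omega, h3⟩
      · exact ⟨t, hat, by omega, hm', hm⟩
  have hback : ∀ d k t, k + d < q * w → a ≤ t → v (i + 1) j (k + d) ∈ c t →
      ∃ σ : ℕ → ℕ, (∀ l ≤ d, a ≤ σ l ∧ σ l < t ∧
        v i ((k + l) % w) (q * w - 1) ∈ c (σ l)) ∧ (∀ l < d, σ l < σ (l + 1)) ∧
        v (i + 1) j k ∈ c (σ 0 + 1) := by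
    intro d
    induction d with
    | zero =>
      intro k t hk hat hm
      obtain ⟨σ, h1, h2, h3, h4⟩ := hfirst k t hk hat hm
      refine ⟨fun _ => σ, ?_, by simp, h4⟩
      intro l hl
      obtain rfl : l = 0 := by omega
      exact ⟨h1, h2, hleg _ _ h3 h4 (hp2 i j k hi hj hk)⟩
    | succ d ihd =>
      intro k t hk hat hm
      obtain ⟨τ, h1, h2, h3, h4⟩ := hfirst _ t hk hat hm
      have hsub := hleg _ _ h3 h4
      have hm' := hsub (hp1 (i + 1) j (k + d) hi hj (by omega))
      obtain ⟨σ, e1, e2, e3⟩ := ihd k τ (by omega) h1 hm'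
      refine ⟨fun l => if l ≤ d then σ l else τ, ?_, ?_, by simpa using e3⟩
      · intro l hl
        by_cases hld : l ≤ d
        · simp only [hld, if_true]
          obtain ⟨f1, f2, f3⟩ := e1 l hld
          exact ⟨f1, by omega, f3⟩
        · obtain rfl : l = d + 1 := by omega
          simp only [hld, if_false]
          exact ⟨h1, h2, hsub (hp2 i j _ hi hj hk)⟩
      · intro l hl
        by_cases hld : l + 1 ≤ d
        · simp only [hld, show l ≤ d by omega, if_true]
          exact e2 l (by omega)
        · obtain rfl : l = d := by omega
          simp only [hld, le_refl, if_true, if_false]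
          exact (e1 l (le_refl _)).2.1
  obtain ⟨σ, g1, g2, -⟩ := hback (q * w - 1) 0 b (by omega) ht.1 (by simpa using ht.2)
  simp only [Nat.zero_add] at g1
  have hmono : ∀ d l, l + d ≤ q * w - 1 → σ l ≤ σ (l + d) := by
    intro d
    induction d with
    | zero => intro l _; simp
    | succ d ihd =>
      intro l hl
      have := ihd l (by omega)
      have := g2 (l + d) (by omega)
      rw [← add_assoc]; omega
  have hblock : ∀ g, (g + 1) * w ≤ q * w → σ (g * w) + D ≤ σ (g * w + (w - 1)) := by
    intro g hg
    rw [add_mul, one_mul] at hg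
    set J := (Finset.range w).filter fun j' => v i j' (q * w - 1) ∉ c (σ (g * w)) with hJ
    refine ih _ _ J (hmono _ _ (by omega)) ?_ ?_ ?_
    · have hle : ((Finset.range w).filter fun j' => v i j' (q * w - 1) ∈ c (σ (g * w))).card
          ≤ s := by
        refine le_trans ?_ (hcard (σ (g * w)))
        refine Finset.card_le_card_of_injOn (fun j' => v i j' (q * w - 1)) ?_ ?_
        · intro x hx
          simp only [Finset.coe_filter, Set.mem_ofPred_eq] at hx
          exact hx.2
        · intro x hx y hy hxy
          simp only [Finset.coe_filter, Set.mem_ofPred_eq, Finset.mem_range] at hx hy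
          exact hinj i x _ y _ (by omega) hx.1 (by omega) hy.1 (by omega) hxy
      have hsum := Finset.card_filter_add_card_filter_not (s := Finset.range w)
        (fun j' => v i j' (q * w - 1) ∈ c (σ (g * w)))
      rw [Finset.card_range] at hsum
      rw [hJ]
      omega
    · intro x hx
      exact Finset.mem_range.1 (Finset.mem_filter.1 hx).1
    · intro x hx
      obtain ⟨hx1, hx2⟩ := Finset.mem_filter.1 hx
      have hx1 := Finset.mem_range.1 hx1
      refine ⟨hx2, σ (g * w + x), hmono _ _ (by omega), ?_, ?_⟩
      · have := hmono (w - 1 - x) (g * w + x) (by omega)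
        rwa [show g * w + x + (w - 1 - x) = g * w + (w - 1) by omega] at this
      · have := (g1 (g * w + x) (by omega)).2.2
        rwa [Nat.mul_comm g w, Nat.mul_add_mod, Nat.mod_eq_of_lt hx1, Nat.mul_comm w g] at this
  have hfin : ∀ g, g + 1 ≤ q → a + (g + 1) * D ≤ σ (g * w + (w - 1)) := by
    intro g
    induction g with
    | zero =>
      intro hg
      have h1 := hblock 0 (Nat.mul_le_mul_right _ hg)
      have h2 := (g1 0 (by omega)).1
      simp only [Nat.zero_mul] at h1 ⊢
      omega
    | succ g ihg =>
      intro hg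
      have h0 := ihg (by omega)
      have hgm : (g + 1 + 1) * w ≤ q * w := Nat.mul_le_mul_right _ hg
      have h1 := hblock (g + 1) hgm
      have h2 := g2 (g * w + (w - 1)) (by rw [add_mul, add_mul] at hgm; omega)
      rw [show g * w + (w - 1) + 1 = (g + 1) * w by rw [add_mul]; omega] at h2
      rw [add_mul (g + 1)]
      omega
  have hlast := hfin (q - 1) (by omega)
  rw [Nat.sub_add_cancel hq] at hlast
  have := (g1 ((q - 1) * w + (w - 1)) (by
    have : (q - 1) * w + w = q * w := by
      rw [← Nat.succ_mul, Nat.succ_eq_add_one, Nat.sub_add_cancel hq]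
    omega)).2.1
  omega

lemma sinks_lb
    (hleg : ∀ t u, u ∉ c t → u ∈ c (t + 1) → pred u ⊆ c t)
    (hcard : ∀ t, (c t).card ≤ s) (hw : 2 * s + 1 ≤ w)
    (hp1 : ∀ i j k, i < R → j < w → k + 1 < q * w → v i j k ∈ pred (v i j (k + 1)))
    (hp2 : ∀ i j k, i + 1 < R → j < w → k < q * w →
      v i (k % w) (q * w - 1) ∈ pred (v (i + 1) j k))
    (hinj : ∀ i j k j' k', i < R → j < w → k < q * w → j' < w → k' < q * w →
      v i j k = v i j' k' → j = j') (hq : 1 ≤ q) (i : ℕ) : i < R →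
    ∀ a b (J : Finset ℕ), a ≤ b → s < J.card → (∀ j ∈ J, j < w) →
      (∀ j ∈ J, v i j (q * w - 1) ∉ c a ∧ ∃ t, a ≤ t ∧ t ≤ b ∧ v i j (q * w - 1) ∈ c t) →
      a + q ^ i ≤ b := by
  classical
  induction i with
  | zero =>
    intro _ a b J hab hJ _ hJ2
    obtain ⟨j, hj⟩ := Finset.card_pos.1 (lt_of_le_of_lt (Nat.zero_le s) hJ)
    obtain ⟨h1, t, h2, h3, h4⟩ := hJ2 j hj
    have : a ≠ t := by rintro rfl; exact h1 h4
    simp; omega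
  | succ i ih =>
    intro hi a b J hab hJ hJ1 hJ2
    have hex : ∃ j ∈ J, ∀ k < q * w, v (i + 1) j k ∉ c a := by
      by_contra hcon
      push Not at hcon
      choose! κ hκ1 hκ2 using hcon
      have : J.card ≤ (c a).card := by
        refine Finset.card_le_card_of_injOn (fun j => v (i + 1) j (κ j)) ?_ ?_
        · intro x hx; exact hκ2 x hx
        · intro x hx y hy hxy
          exact hinj (i + 1) x _ y _ hi (hJ1 x hx) (hκ1 x hx) (hJ1 y hy) (hκ1 y hy) hxy
      have := hcard a
      omega
    obtain ⟨j, hj, hemp⟩ := hex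
    obtain ⟨-, t, h2, h3, h4⟩ := hJ2 j hj
    have := traverse hleg hcard hw hp1 hp2 hinj hq i hi (q ^ i) (ih (by omega)) a t j
      (hJ1 j hj) hemp ⟨h2, h4⟩
    rw [pow_succ']; omega

lemma pebble_lb
    (hleg : ∀ t u, u ∉ c t → u ∈ c (t + 1) → pred u ⊆ c t)
    (hcard : ∀ t, (c t).card ≤ s) (hw : 2 * s + 1 ≤ w)
    (hp1 : ∀ i j k, i < R → j < w → k + 1 < q * w → v i j k ∈ pred (v i j (k + 1)))
    (hp2 : ∀ i j k, i + 1 < R → j < w → k < q * w →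
      v i (k % w) (q * w - 1) ∈ pred (v (i + 1) j k))
    (hinj : ∀ i j k j' k', i < R → j < w → k < q * w → j' < w → k' < q * w →
      v i j k = v i j' k' → j = j') (hq : 1 ≤ q) (i T : ℕ) (hi : i + 1 < R)
    (h0 : c 0 = ∅) (hT : v (i + 1) 0 (q * w - 1) ∈ c T) : q ^ (i + 1) ≤ T := by
  have := traverse hleg hcard hw hp1 hp2 hinj hq i hi (q ^ i)
    (sinks_lb hleg hcard hw hp1 hp2 hinj hq i (by omega)) 0 T 0 (by omega) (by simp [h0])
    ⟨Nat.zero_le _, hT⟩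
  rw [pow_succ']; omega
end LB

/-! ### The graphs -/

/-- Width of a level (`f + 1` is the number of levels). -/
def gW (f : ℕ) : ℕ := (f + 1) ^ 2

/-- Length of a spine. -/
def gL (f : ℕ) : ℕ := (f + 1) * gW f

/-- Number of vertices. -/
def gN (f : ℕ) : ℕ := (f + 1) * (gW f * gL f)

lemma gW_pos (f : ℕ) : 0 < gW f := by unfold gW; positivity
lemma gL_pos (f : ℕ) : 0 < gL f := Nat.mul_pos (Nat.succ_pos f) (gW_pos f)
lemma gN_pos (f : ℕ) : 0 < gN f :=
  Nat.mul_pos (Nat.succ_pos f) (Nat.mul_pos (gW_pos f) (gL_pos f))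

lemma gN_eq (f : ℕ) : gN f = (f + 1) ^ 6 := by unfold gN gL gW; ring

/-- The `k`-th vertex of the `j`-th spine of level `i`. -/
def vt (f i j k : ℕ) : Fin (gN f) := ⟨((i * gW f + j) * gL f + k) % gN f, Nat.mod_lt _ (gN_pos f)⟩

/-- The predecessors of a vertex. -/
def pd (f : ℕ) (x : Fin (gN f)) : Finset (Fin (gN f)) :=
  (if x.1 % gL f = 0 then ∅
    else {vt f (x.1 / gL f / gW f) (x.1 / gL f % gW f) (x.1 % gL f - 1)}) ∪
  (if x.1 / gL f / gW f = 0 then ∅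
    else {vt f (x.1 / gL f / gW f - 1) (x.1 % gL f % gW f) (gL f - 1)})

lemma pd_card (f : ℕ) (x : Fin (gN f)) : (pd f x).card ≤ 2 := by
  unfold pd
  refine (Finset.card_union_le _ _).trans ?_
  split_ifs <;> simp

lemma vt_val {f i j k : ℕ} (hi : i < f + 1) (hj : j < gW f) (hk : k < gL f) :
    (vt f i j k).1 = (i * gW f + j) * gL f + k := by
  refine Nat.mod_eq_of_lt ?_
  have h1 : i * gW f + j + 1 ≤ (f + 1) * gW f := by
    calc i * gW f + j + 1 ≤ i * gW f + gW f := by omega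
      _ = (i + 1) * gW f := by ring
      _ ≤ (f + 1) * gW f := Nat.mul_le_mul_right _ hi
  calc (i * gW f + j) * gL f + k < (i * gW f + j) * gL f + gL f := by omega
    _ = (i * gW f + j + 1) * gL f := by ring
    _ ≤ (f + 1) * gW f * gL f := Nat.mul_le_mul_right _ h1
    _ = gN f := by unfold gN; ring

lemma vt_dec {f i j k : ℕ} (hi : i < f + 1) (hj : j < gW f) (hk : k < gL f) :
    (vt f i j k).1 % gL f = k ∧ (vt f i j k).1 / gL f / gW f = i ∧
      (vt f i j k).1 / gL f % gW f = j := by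
  rw [vt_val hi hj hk]
  have h1 : ((i * gW f + j) * gL f + k) / gL f = i * gW f + j := by
    rw [mul_comm, Nat.mul_add_div (gL_pos f), Nat.div_eq_of_lt hk, add_zero]
  rw [h1]
  refine ⟨?_, ?_, ?_⟩
  · rw [mul_comm, Nat.mul_add_mod, Nat.mod_eq_of_lt hk]
  · rw [mul_comm, Nat.mul_add_div (gW_pos f), Nat.div_eq_of_lt hj, add_zero]
  · rw [mul_comm, Nat.mul_add_mod, Nat.mod_eq_of_lt hj]

lemma pd_vt {f i j k : ℕ} (hi : i < f + 1) (hj : j < gW f) (hk : k < gL f) :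
    pd f (vt f i j k) = (if k = 0 then ∅ else {vt f i j (k - 1)}) ∪
      (if i = 0 then ∅ else {vt f (i - 1) (k % gW f) (gL f - 1)}) := by
  obtain ⟨h1, h2, h3⟩ := vt_dec hi hj hk
  unfold pd
  rw [h1, h2, h3]

/-- The pebbling formula. -/
def peb (f : ℕ) : CNF where
  nvars := gN f
  clauses := insert (∅, {vt f f 0 (gL f - 1)})
    (Finset.univ.image fun x : Fin (gN f) => (({x}, pd f x) : Clause (gN f)))

lemma peb_cases (f : ℕ) : ∀ C ∈ (peb f).clauses,
    C = (∅, {vt f f 0 (gL f - 1)}) ∨ ∃ x, C = ({x}, pd f x) := by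
  intro C hC
  rcases Finset.mem_insert.1 hC with h | h
  · exact Or.inl h
  · obtain ⟨x, -, rfl⟩ := Finset.mem_image.1 h
    exact Or.inr ⟨x, rfl⟩

/-- The vertices, as variables of the pebbling formula. -/
def vq (f i j k : ℕ) : Fin (peb f).nvars := vt f i j k

lemma peb_sink (f : ℕ) : ((∅, {vq f f 0 (gL f - 1)}) : Clause (peb f).nvars) ∈ (peb f).clauses :=
  Finset.mem_insert_self _ _

lemma peb_vert (f : ℕ) (x : Fin (gN f)) : (({x}, pd f x) : Clause (gN f)) ∈ (peb f).clauses :=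
  Finset.mem_insert_of_mem (Finset.mem_image_of_mem _ (Finset.mem_univ x))

lemma peb_card_one (f : ℕ) : ∀ C ∈ (peb f).clauses, C.1.card ≤ 1 := by
  intro C hC
  rcases peb_cases f C hC with rfl | ⟨x, rfl⟩
  · exact (Finset.card_empty).le.trans (by norm_num)
  · exact (Finset.card_singleton x).le

lemma peb_3cnf (f : ℕ) : (peb f).Is3CNF := by
  intro C hC
  rcases peb_cases f C hC with rfl | ⟨x, rfl⟩
  · change (∅ : Finset (Fin (gN f))).card + ({vt f f 0 (gL f - 1)} : Finset (Fin (gN f))).card ≤ 3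
    simp
  · change ({x} : Finset (Fin (gN f))).card + (pd f x).card ≤ 3
    have := pd_card f x
    rw [Finset.card_singleton]; omega

lemma peb_clauses_card (f : ℕ) : (peb f).clauses.card = gN f + 1 := by
  unfold peb
  simp only
  rw [Finset.card_insert_of_notMem, Finset.card_image_of_injective]
  · simp
  · intro x y hxy
    simpa using congrArg Prod.fst hxy
  · intro h
    obtain ⟨x, -, hx⟩ := Finset.mem_image.1 h
    simpa using congrArg Prod.fst hx

section Upper
variable {F : Type} [Field F] {f : ℕ}

lemma adds_step {A : Finset (Fin (peb f).nvars)} {i j k : ℕ} (hi : i < f + 1) (hj : j < gW f)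
    (hk : k < gL f) (h1 : k ≠ 0 → vq f i j (k - 1) ∈ A)
    (h2 : i ≠ 0 → vq f (i - 1) (k % gW f) (gL f - 1) ∈ A) :
    Adds F (peb f) A {vq f i j k} 1 1 := by
  intro P hP
  have hc : (({vq f i j k}, pd f (vt f i j k)) : Clause (peb f).nvars) ∈ (peb f).clauses :=
    peb_vert f (vt f i j k)
  refine Der.step hc (Finset.Subset.trans ?_ hP) (le_refl _) (le_refl _)
  rw [pd_vt hi hj hk]
  refine Finset.union_subset ?_ ?_
  · split_ifs with h
    · exact Finset.empty_subset _
    · exact Finset.singleton_subset_iff.2 (h1 h)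
  · split_ifs with h
    · exact Finset.empty_subset _
    · exact Finset.singleton_subset_iff.2 (h2 h)

/-- The chain of a spine. -/
def chain (f i j : ℕ) : ℕ → Finset (Fin (peb f).nvars)
  | 0 => ∅
  | k + 1 => {vq f i j k}

lemma chain_card (f i j k : ℕ) : (chain f i j k).card ≤ 1 := by
  cases k <;> simp [chain]

lemma chain_mem {f i j k : ℕ} (hk : k ≠ 0) : vq f i j (k - 1) ∈ chain f i j k := by
  cases k with
  | zero => exact absurd rfl hk
  | succ k => simp [chain]

lemma upper1 (m : ℕ) (hm : gL f ≤ 2 ^ m) (i : ℕ) : i < f + 1 →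
    ∃ t, ∀ j < gW f, Adds F (peb f) ∅ {vq f i j (gL f - 1)} t ((i + 1) * (m + 1)) := by
  induction i with
  | zero =>
    intro hi
    refine ⟨(2 * 2 - 1) ^ m * 1, fun j hj => ?_⟩
    have := bennett (F := F) (φ := peb f) (S := ∅) (A := chain f 0 j) (t := 1) (e := 1) (w := 1)
      (k := 2) (B := gL f) (by norm_num) (chain_card f 0 j) (fun k hk => by
        refine adds_step hi hj hk (fun h => Finset.mem_union_left _ (chain_mem h))
          (fun h => absurd rfl h)) m 0 (gL f) (gL_pos f) hm (by omega)
    rw [Nat.zero_add, show gL f = gL f - 1 + 1 from (Nat.sub_add_cancel (gL_pos f)).symm] at this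
    refine this.mono (by simp [chain]) (le_refl _) (by omega)
  | succ i ih =>
    intro hi
    obtain ⟨t, ht⟩ := ih (by omega)
    refine ⟨(2 * 2 - 1) ^ m * (t + 1 + t), fun j hj => ?_⟩
    have := bennett (F := F) (φ := peb f) (S := ∅) (A := chain f (i + 1) j) (t := t + 1 + t)
      (e := 1 + max ((i + 1) * (m + 1)) 1) (w := 1)
      (k := 2) (B := gL f) (by norm_num) (chain_card f (i + 1) j) (fun k hk => by
        refine Adds.via (M := {vq f i (k % gW f) (gL f - 1)}) ((ht _ (Nat.mod_lt _ (gW_pos f))).mono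
          (Finset.empty_subset _) (le_refl _) (le_refl _)) ?_ (by simp) (chain_card _ _ _ _)
        refine adds_step hi hj hk
          (fun h => Finset.mem_union_left _ (Finset.mem_union_left _ (chain_mem h)))
          (fun h => ?_)
        refine Finset.mem_union_right _ ?_
        simp) m 0 (gL f) (gL_pos f) hm (by omega)
    rw [Nat.zero_add, show gL f = gL f - 1 + 1 from (Nat.sub_add_cancel (gL_pos f)).symm] at this
    refine this.mono (by simp [chain]) (le_refl _) ?_
    have h1 : 1 ≤ (i + 1) * (m + 1) := Nat.mul_pos (by omega) (by omega)
    rw [max_eq_left h1]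
    apply le_of_eq
    ring

/-- The sinks of the levels. -/
def lev (f : ℕ) : ℕ → Finset (Fin (peb f).nvars)
  | 0 => ∅
  | i + 1 => (Finset.range (gW f)).image fun j => vq f i j (gL f - 1)

lemma lev_card (f i : ℕ) : (lev f i).card ≤ gW f := by
  cases i with
  | zero => simp [lev]
  | succ i => exact Finset.card_image_le.trans (by simp)

lemma lev_mem {f i j : ℕ} (hi : i ≠ 0) (hj : j < gW f) : vq f (i - 1) j (gL f - 1) ∈ lev f i := by
  cases i with
  | zero => exact absurd rfl hi
  | succ i => exact Finset.mem_image.2 ⟨j, Finset.mem_range.2 hj, rfl⟩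

lemma upper2 (k m m' : ℕ) (hk : 1 ≤ k) (hm : gL f ≤ k ^ m) (hm' : f + 1 ≤ k ^ m') :
    Adds F (peb f) ∅ (lev f (f + 1)) ((2 * k - 1) ^ m' * (gW f * ((2 * k - 1) ^ m * 1)))
      (gW f + (1 + m * (k - 1) * 1) + m' * (k - 1) * gW f) := by
  have hlev : ∀ i, i < f + 1 → Adds F (peb f) (lev f i ∪ ∅) (lev f (i + 1))
      (gW f * ((2 * k - 1) ^ m * 1)) (gW f + (1 + m * (k - 1) * 1)) := by
    intro i hi
    refine adds_many (gW f) fun j hj => ?_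
    have := bennett (F := F) (φ := peb f) (S := lev f i ∪ ∅) (A := chain f i j) (t := 1) (e := 1)
      (w := 1) (k := k) (B := gL f) hk (chain_card f i j) (fun k hk => by
        refine adds_step hi hj hk (fun h => Finset.mem_union_left _ (chain_mem h))
          (fun h => ?_)
        exact Finset.mem_union_right _ (Finset.mem_union_left _
          (lev_mem h (Nat.mod_lt _ (gW_pos f))))) m 0 (gL f) (gL_pos f) hm (by omega)
    rw [Nat.zero_add, show gL f = gL f - 1 + 1 from (Nat.sub_add_cancel (gL_pos f)).symm] at this
    refine this.mono ?_ (le_refl _) (le_refl _)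
    exact Finset.union_subset (by simp [chain]) (Finset.Subset.refl _)
  have := bennett (F := F) (φ := peb f) (S := ∅) (A := lev f) hk (lev_card f) hlev m' 0 (f + 1)
    (by omega) hm' (by omega)
  rw [Nat.zero_add] at this
  exact this.mono (by simp [lev]) (le_refl _) (le_refl _)

lemma cert1 (F : Type) [Field F] (f m : ℕ) (hm : gL f ≤ 2 ^ m) :
    ∃ r s, IsNSCert ((peb f).polys F) r s ∧
      nsDegree ((peb f).polys F) r s ≤ (f + 1) * (m + 1) := by
  obtain ⟨t, ht⟩ := upper1 (F := F) m hm f (by omega)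
  have h := ht 0 (gW_pos f) ∅ (Finset.Subset.refl _)
  rw [Finset.card_empty, Nat.zero_add] at h
  obtain ⟨r, s, h1, -, h3⟩ := h.cert (z := vq f f 0 (gL f - 1))
    (Finset.mem_union_right _ (Finset.mem_singleton_self _)) (peb_sink f) (by
      have : 1 ≤ (f + 1) * (m + 1) := Nat.mul_pos (by omega) (by omega)
      simpa using this) (peb_card_one f)
  exact ⟨r, s, h1, h3⟩

lemma cert2 (F : Type) [Field F] (f k m m' : ℕ) (hk : 1 ≤ k) (hm : gL f ≤ k ^ m)
    (hm' : f + 1 ≤ k ^ m') :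
    ∃ r s, IsNSCert ((peb f).polys F) r s ∧
      nsSize ((peb f).polys F) r s ≤ 2 * ((2 * k - 1) ^ m' * (gW f * (2 * k - 1) ^ m) + 1) ∧
      nsDegree ((peb f).polys F) r s ≤ gW f + (1 + m * (k - 1)) + m' * (k - 1) * gW f := by
  have h := upper2 (F := F) k m m' hk hm hm' ∅ (Finset.Subset.refl _)
  rw [Finset.card_empty, Nat.zero_add, mul_one, mul_one] at h
  refine h.cert (z := vq f f 0 (gL f - 1))
    (Finset.mem_union_right _ (lev_mem (Nat.succ_ne_zero f) (gW_pos f))) (peb_sink f) ?_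
    (peb_card_one f)
  rw [Finset.empty_union]
  have := lev_card f (f + 1)
  omega

lemma peb_unsat (f : ℕ) : (peb f).Unsat := by
  classical
  obtain ⟨r, s, h, -⟩ := cert1 ℚ f (gL f) Nat.lt_two_pow_self.le
  intro a
  by_contra hcon
  push Not at hcon
  unfold IsNSCert at h
  have := congrArg (MvPolynomial.eval (fun x => if a x then (1 : ℚ) else 0)) h
  rw [map_add, map_sum, map_sum, Finset.sum_eq_zero, Finset.sum_eq_zero] at this
  · simp at this
  · intro x _
    cases hx : a x <;> simp [hx]
  · intro C _
    rw [map_mul]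
    refine mul_eq_zero_of_right _ ?_
    unfold CNF.polys Clause.poly
    rw [map_mul, map_prod, map_prod]
    rcases hcon C.1 C.2 with ⟨x, hx, hax⟩ | ⟨x, hx, hax⟩
    · refine mul_eq_zero_of_left (Finset.prod_eq_zero hx ?_) _
      simp [hax]
    · refine mul_eq_zero_of_right _ (Finset.prod_eq_zero hx ?_)
      simp [hax]
end Upper

lemma lower {F : Type} [Field F] {f : ℕ} (hf : 1 ≤ f) {r s}
    (h : IsNSCert ((peb f).polys F) r s)
    (hd : 2 * (nsDegree ((peb f).polys F) r s + 3) + 1 ≤ gW f) :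
    (f + 1) ^ f ≤ nsSize ((peb f).polys F) r s := by
  obtain ⟨c, T, h0, hT, hleg, hcard, hsize⟩ := exists_walk (φ := peb f) (pd f)
    (vt f f 0 (gL f - 1)) (peb_cases f) (pd_card f) h
  refine le_trans ?_ hsize
  have key := pebble_lb (V := Fin (gN f)) (v := vt f) (pred := pd f) (R := f + 1) (w := gW f)
    (q := f + 1) (c := c) hleg hcard hd ?_ ?_ ?_ (by omega) (f - 1) T (by omega) h0 ?_
  · rwa [Nat.sub_add_cancel hf] at key
  · intro i j k hi hj hk
    rw [pd_vt hi hj hk]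
    simp
  · intro i j k hi hj hk
    rw [pd_vt hi hj hk]
    simp [gL]
  · intro i j k j' k' hi hj hk hj' hk' he
    have h1 := (vt_dec hi hj hk).2.2
    have h2 := (vt_dec hi hj' hk').2.2
    rw [he] at h1
    exact h1.symm.trans h2
  · rw [Nat.sub_add_cancel hf]; exact hT

/-! ### Numerical estimates -/

lemma pow_clog_le {k L : ℕ} (hk : 2 ≤ k) (hL : 1 ≤ L) : k ^ Nat.clog k L ≤ k * L := by
  rcases Nat.lt_or_ge 1 L with h | h
  · have h1 := Nat.pow_pred_clog_lt_self (b := k) (by omega) h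
    have h2 : 0 < Nat.clog k L := Nat.clog_pos (by omega) h
    calc k ^ Nat.clog k L = k * k ^ (Nat.clog k L).pred := by
          rw [← pow_succ', Nat.pred_eq_sub_one, Nat.sub_add_cancel h2]
      _ ≤ k * L := Nat.mul_le_mul_left _ h1.le
  · obtain rfl : L = 1 := by omega
    simp; omega

lemma clog_le {k L n : ℕ} (hk : 2 ≤ k) (hL : 1 ≤ L) (hn : 2 ≤ n) (hLn : L ≤ n) :
    (Nat.clog k L : ℝ) ≤ 2 * Real.logb 2 n := by
  have hn' : (2 : ℝ) ≤ n := by exact_mod_cast hn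
  have h1 : 1 ≤ Real.logb 2 n := by
    rw [Real.le_logb_iff_rpow_le (by norm_num) (by linarith)]; simpa using hn'
  rcases Nat.lt_or_ge 1 L with h | h
  · have h1' := Nat.pow_pred_clog_lt_self (b := k) (by omega) h
    have h2 : 0 < Nat.clog k L := Nat.clog_pos (by omega) h
    have h3 : 2 ^ (Nat.clog k L - 1) ≤ n :=
      (Nat.pow_le_pow_left hk _).trans (h1'.le.trans hLn)
    have h4 : ((Nat.clog k L - 1 : ℕ) : ℝ) ≤ Real.logb 2 n := by
      rw [Real.le_logb_iff_rpow_le (by norm_num) (by linarith), Real.rpow_natCast]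
      exact_mod_cast h3
    rw [Nat.cast_sub h2] at h4
    push_cast at h4
    linarith
  · obtain rfl : L = 1 := by omega
    simp; linarith

lemma root_facts (n : ℕ) (hn : 1 ≤ n) : ∃ y : ℝ, y = (n : ℝ) ^ ((1 : ℝ) / 6) ∧ 1 ≤ y ∧ y ^ 6 = n ∧
    (n : ℝ) ^ ((1 : ℝ) / 3) = y ^ 2 ∧ y < (⌊y⌋₊ + 1 : ℝ) ∧ (⌊y⌋₊ + 1 : ℝ) ≤ 2 * y := by
  have hn' : (1 : ℝ) ≤ n := by exact_mod_cast hn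
  have hy : 1 ≤ (n : ℝ) ^ ((1 : ℝ) / 6) := Real.one_le_rpow hn' (by norm_num)
  refine ⟨_, rfl, hy, ?_, ?_, Nat.lt_floor_add_one _, ?_⟩
  · rw [← Real.rpow_natCast, ← Real.rpow_mul (by linarith)]; norm_num
  · rw [← Real.rpow_natCast, ← Real.rpow_mul (by linarith)]; norm_num
  · have := Nat.floor_le (a := (n : ℝ) ^ ((1 : ℝ) / 6)) (by linarith)
    linarith

lemma gL_eq (f : ℕ) : gL f = (f + 1) ^ 3 := by unfold gL gW; ring

lemma gL_le {n : ℕ} (hn : 64 ≤ n) : gL ⌊(n : ℝ) ^ ((1 : ℝ) / 6)⌋₊ ≤ n := by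
  obtain ⟨y, hy, h1, h6, h3, hlt, hle⟩ := root_facts n (by omega)
  rw [← hy, gL_eq]
  have hn' : (64 : ℝ) ≤ n := by exact_mod_cast hn
  have h8 : (8 : ℝ) ≤ y ^ 3 := by
    rw [← h6] at hn'
    have : 0 < y ^ 3 := by positivity
    nlinarith
  have : ((⌊y⌋₊ + 1 : ℝ)) ^ 3 ≤ (2 * y) ^ 3 := pow_le_pow_left₀ (by positivity) hle 3
  have : ((⌊y⌋₊ + 1 : ℝ)) ^ 3 ≤ n := by rw [← h6]; nlinarith
  exact_mod_cast this

lemma time_bound {a m L : ℕ} (ha : 1 ≤ a) (hm : (2 ^ a) ^ m ≤ 2 ^ a * L) :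
    (((2 * 2 ^ a - 1) ^ m : ℕ) : ℝ) ≤ ((2 : ℝ) ^ a * L) ^ (1 + 1 / (a : ℝ)) := by
  have ha' : (0 : ℝ) < a := by exact_mod_cast ha
  have h1 : (2 * 2 ^ a - 1) ^ m ≤ (2 ^ (a + 1)) ^ m :=
    Nat.pow_le_pow_left (by rw [pow_succ']; omega) m
  have h2 : (((2 ^ (a + 1)) ^ m : ℕ) : ℝ) = (((2 : ℝ) ^ a) ^ m) ^ (1 + 1 / (a : ℝ)) := by
    push_cast
    rw [← pow_mul, ← pow_mul, ← Real.rpow_natCast, ← Real.rpow_natCast,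
      ← Real.rpow_mul (by norm_num)]
    congr 1
    push_cast
    field_simp
  calc (((2 * 2 ^ a - 1) ^ m : ℕ) : ℝ) ≤ (((2 ^ (a + 1)) ^ m : ℕ) : ℝ) := by exact_mod_cast h1
    _ = (((2 : ℝ) ^ a) ^ m) ^ (1 + 1 / (a : ℝ)) := h2
    _ ≤ _ := by
      refine Real.rpow_le_rpow (by positivity) ?_ (by positivity)
      exact_mod_cast hm

lemma part1 (F : Type) [Field F] (n f : ℕ) (hn : 64 ≤ n) (hf : f = ⌊(n : ℝ) ^ ((1 : ℝ) / 6)⌋₊) :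
    ∃ r s, IsNSCert ((peb f).polys F) r s ∧
      (nsDegree ((peb f).polys F) r s : ℝ) ≤ 6 * (n : ℝ) ^ ((1 : ℝ) / 6) * Real.logb 2 n := by
  obtain ⟨y, hy, h1, h6, h3, hlt, hle⟩ := root_facts n (by omega)
  have hgL := gL_le hn
  rw [← hf] at hgL
  rw [← hy] at hf ⊢
  rw [← hf] at hlt hle
  have hc := clog_le (k := 2) (le_refl 2) (gL_pos _) (by omega) hgL
  obtain ⟨r, s, hcert, hdeg⟩ := cert1 F f _
    (Nat.le_pow_clog (by norm_num) _)
  refine ⟨r, s, hcert, ?_⟩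
  have hn' : (2 : ℝ) ≤ n := by exact_mod_cast (show 2 ≤ n by omega)
  have hlog : 1 ≤ Real.logb 2 n := by
    rw [Real.le_logb_iff_rpow_le (by norm_num) (by linarith)]; simpa using hn'
  calc (nsDegree ((peb f).polys F) r s : ℝ) ≤ (((f + 1) * (Nat.clog 2 (gL f) + 1) : ℕ) : ℝ) := by
        exact_mod_cast hdeg
    _ = (f + 1 : ℝ) * ((Nat.clog 2 (gL f) : ℝ) + 1) := by push_cast; rfl
    _ ≤ (2 * y) * (3 * Real.logb 2 n) := by
        refine mul_le_mul hle (by linarith) (by positivity) (by linarith)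
    _ = 6 * y * Real.logb 2 n := by ring

set_option maxHeartbeats 1000000 in
lemma part2 (F : Type) [Field F] (ε : ℝ) (hε : 0 < ε) : ∃ C : ℝ, 0 < C ∧ ∀ n f : ℕ, 64 ≤ n →
    f = ⌊(n : ℝ) ^ ((1 : ℝ) / 6)⌋₊ →
    ∃ r s, IsNSCert ((peb f).polys F) r s ∧
      (nsSize ((peb f).polys F) r s : ℝ) ≤ C * (n : ℝ) ^ ((1 : ℝ) + ε) ∧
      (nsDegree ((peb f).polys F) r s : ℝ) ≤ C * (n : ℝ) ^ ((1 : ℝ) / 3) * Real.logb 2 n := by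
  obtain ⟨a0, ha0⟩ := exists_nat_gt (1 / ε)
  set a := a0 + 1 with ha
  have ha1 : 1 ≤ a := by omega
  have haε : 1 / (a : ℝ) ≤ ε := by
    rw [div_le_comm₀ (by positivity) hε, ha]; push_cast; linarith
  set k : ℕ := 2 ^ a with hk
  have hk2 : 2 ≤ k := by
    rw [hk]
    calc 2 = 2 ^ 1 := by norm_num
      _ ≤ 2 ^ a := Nat.pow_le_pow_right (by norm_num) ha1
  set β : ℝ := 1 + 1 / (a : ℝ) with hβ
  have hβ1 : 1 ≤ β := by rw [hβ]; have : 0 ≤ 1 / (a : ℝ) := by positivity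
                         linarith
  refine ⟨4 * ((k : ℝ) ^ 2 * 64) ^ β + 4 * (4 * k + 2), by positivity, fun n f hn hf => ?_⟩
  obtain ⟨y, hy, h1, h6, h3, hlt, hle⟩ := root_facts n (by omega)
  have hgL := gL_le hn
  rw [← hf] at hgL
  rw [← hy] at hf
  rw [← hf] at hlt hle
  have hR : f + 1 ≤ gL f := by
    unfold gL; exact Nat.le_mul_of_pos_right _ (gW_pos f)
  have hn' : (2 : ℝ) ≤ n := by exact_mod_cast (show 2 ≤ n by omega)
  have hlog : 1 ≤ Real.logb 2 n := by
    rw [Real.le_logb_iff_rpow_le (by norm_num) (by linarith)]; simpa using hn'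
  set m := Nat.clog k (gL f) with hm
  set m' := Nat.clog k (f + 1) with hm'
  have hc : (m : ℝ) ≤ _ := clog_le hk2 (gL_pos f) (by omega) hgL
  have hc' : (m' : ℝ) ≤ _ := clog_le hk2 (Nat.succ_pos f) (by omega) (hR.trans hgL)
  have hp : k ^ m ≤ k * gL f := pow_clog_le hk2 (gL_pos f)
  have hp' : k ^ m' ≤ k * (f + 1) := pow_clog_le hk2 (Nat.succ_pos f)
  obtain ⟨r, s, hcert, hsize, hdeg⟩ := cert2 F f k m m' (by omega)
    (Nat.le_pow_clog (by omega) _) (Nat.le_pow_clog (by omega) _)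
  refine ⟨r, s, hcert, ?_, ?_⟩
  · have t1 := time_bound ha1 hp
    have t2 := time_bound ha1 hp'
    rw [← hβ, ← hk] at t1 t2
    have hkr : ((2 : ℝ) ^ a) = k := by rw [hk]; push_cast; rfl
    rw [hkr] at t1 t2
    set t : ℕ := (2 * k - 1) ^ m' * (gW f * (2 * k - 1) ^ m) with ht
    have htpos : 1 ≤ t := by
      have h0 : 0 < 2 * k - 1 := by omega
      exact Nat.mul_pos (Nat.pow_pos h0) (Nat.mul_pos (gW_pos f) (Nat.pow_pos h0))
    have hW1 : (1 : ℝ) ≤ gW f := by exact_mod_cast gW_pos f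
    have hWβ : (gW f : ℝ) ≤ (gW f : ℝ) ^ β := by
      calc (gW f : ℝ) = (gW f : ℝ) ^ (1 : ℝ) := (Real.rpow_one _).symm
        _ ≤ _ := Real.rpow_le_rpow_of_exponent_le hW1 hβ1
    have e2 : (f + 1 : ℝ) ^ 6 ≤ (2 * y) ^ 6 := pow_le_pow_left₀ (by positivity) hle 6
    rw [mul_pow, h6] at e2
    have htr : (t : ℝ) ≤ ((k : ℝ) ^ 2 * 64) ^ β * (n : ℝ) ^ β := by
      calc (t : ℝ) = (((2 * k - 1) ^ m' : ℕ) : ℝ) * ((gW f : ℝ) * (((2 * k - 1) ^ m : ℕ) : ℝ)) := by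
            rw [ht, Nat.cast_mul, Nat.cast_mul]
        _ ≤ ((k : ℝ) * ((f + 1 : ℕ) : ℝ)) ^ β * ((gW f : ℝ) ^ β * ((k : ℝ) * (gL f : ℝ)) ^ β) := by
            gcongr
        _ = ((k : ℝ) ^ 2 * (f + 1 : ℝ) ^ 6) ^ β := by
            rw [← Real.mul_rpow (by positivity) (by positivity),
              ← Real.mul_rpow (by positivity) (by positivity)]
            congr 1
            rw [gL_eq, gW]; push_cast; ring
        _ ≤ ((k : ℝ) ^ 2 * 64 * n) ^ β := by
            refine Real.rpow_le_rpow (by positivity) ?_ (by linarith)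
            rw [mul_assoc]
            refine mul_le_mul_of_nonneg_left (by linarith) (by positivity)
        _ = _ := Real.mul_rpow (by positivity) (by positivity)
    have hnβ : (n : ℝ) ^ β ≤ (n : ℝ) ^ ((1 : ℝ) + ε) :=
      Real.rpow_le_rpow_of_exponent_le (by linarith) (by rw [hβ]; linarith)
    have hs : (nsSize ((peb f).polys F) r s : ℝ) ≤ 4 * (t : ℝ) := by
      have : nsSize ((peb f).polys F) r s ≤ 4 * t := by omega
      exact_mod_cast this
    calc (nsSize ((peb f).polys F) r s : ℝ) ≤ 4 * (((k : ℝ) ^ 2 * 64) ^ β * (n : ℝ) ^ β) := by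
          linarith
      _ = (4 * ((k : ℝ) ^ 2 * 64) ^ β) * (n : ℝ) ^ β := by ring
      _ ≤ _ := by
          refine mul_le_mul ?_ hnβ (by positivity) (by positivity)
          have : (0 : ℝ) ≤ 4 * (4 * k + 2) := by positivity
          linarith
  · have hW1 : 1 ≤ gW f := gW_pos f
    have hd2 : nsDegree ((peb f).polys F) r s ≤ gW f * (2 + (m + m') * k) := by
      refine hdeg.trans ?_
      have q1 : m * (k - 1) ≤ gW f * (m * k) :=
        (Nat.mul_le_mul_left m (Nat.sub_le k 1)).trans (Nat.le_mul_of_pos_left _ hW1)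
      have q2 : m' * (k - 1) * gW f ≤ gW f * (m' * k) := by
        rw [mul_comm]
        exact Nat.mul_le_mul_left _ (Nat.mul_le_mul_left m' (Nat.sub_le k 1))
      have : gW f * (2 + (m + m') * k) = 2 * gW f + gW f * (m * k) + gW f * (m' * k) := by ring
      omega
    have hWy : (gW f : ℝ) ≤ 4 * y ^ 2 := by
      have : (f + 1 : ℝ) ^ 2 ≤ (2 * y) ^ 2 := pow_le_pow_left₀ (by positivity) hle 2
      rw [gW]; push_cast; rw [mul_pow] at this; linarith
    rw [h3]
    calc (nsDegree ((peb f).polys F) r s : ℝ) ≤ ((gW f * (2 + (m + m') * k) : ℕ) : ℝ) := by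
          exact_mod_cast hd2
      _ = (gW f : ℝ) * (2 + ((m : ℝ) + m') * k) := by push_cast; rfl
      _ ≤ (4 * y ^ 2) * ((2 + 4 * k) * Real.logb 2 n) := by
          refine mul_le_mul hWy ?_ (by positivity) (by positivity)
          have : ((m : ℝ) + m') * k ≤ (4 * Real.logb 2 n) * k :=
            mul_le_mul_of_nonneg_right (by linarith) (by positivity)
          nlinarith
      _ = (4 * (4 * k + 2)) * (y ^ 2 * Real.logb 2 n) := by ring
      _ ≤ (4 * ((k : ℝ) ^ 2 * 64) ^ β + 4 * (4 * k + 2)) * (y ^ 2 * Real.logb 2 n) := by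
          refine mul_le_mul_of_nonneg_right ?_ (by positivity)
          have : (0 : ℝ) ≤ 4 * ((k : ℝ) ^ 2 * 64) ^ β := by positivity
          linarith
      _ = _ := by ring

lemma part3 (F : Type) [Field F] (n f : ℕ) (hn : 4096 ≤ n) (hf : f = ⌊(n : ℝ) ^ ((1 : ℝ) / 6)⌋₊)
    (r s) (hcert : IsNSCert ((peb f).polys F) r s)
    (hdeg : (nsDegree ((peb f).polys F) r s : ℝ) ≤ 1 / 4 * (n : ℝ) ^ ((1 : ℝ) / 3)) :
    Nat.factorial f ≤ nsSize ((peb f).polys F) r s := by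
  obtain ⟨y, hy, h1, h6, h3, hlt, hle⟩ := root_facts n (by omega)
  rw [h3] at hdeg
  rw [← hy] at hf
  rw [← hf] at hlt hle
  have hn' : (4096 : ℝ) ≤ n := by exact_mod_cast hn
  have hy4 : 4 ≤ y := by
    by_contra hcon
    push Not at hcon
    have : y ^ 6 < 4 ^ 6 := pow_lt_pow_left₀ hcon (by linarith) (by norm_num)
    rw [h6] at this
    norm_num at this
    linarith
  have hf1 : 1 ≤ f := hf ▸ Nat.le_floor (by simpa using h1)
  have hd : 2 * (nsDegree ((peb f).polys F) r s + 3) + 1 ≤ gW f := by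
    have : (2 * ((nsDegree ((peb f).polys F) r s : ℝ) + 3) + 1) ≤ (f + 1 : ℝ) ^ 2 := by
      have : y ^ 2 ≤ (f + 1 : ℝ) ^ 2 := pow_le_pow_left₀ (by linarith) hlt.le 2
      nlinarith
    rw [gW]
    exact_mod_cast this
  refine le_trans ?_ (lower hf1 hcert hd)
  exact (Nat.factorial_le_pow _).trans (Nat.pow_le_pow_left (by omega) _)

/-- There is a family of unsatisfiable 3-CNF formulas of size `Θ(n)` such that,
over any field: (1) there is a Nullstellensatz refutation of degree `O(n^{1/6} log n)`;
(2) for every `ε > 0` there is a refutation of size `O(n^{1+ε})` and degree `O(n^{1/3} log n)`;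
(3) there is a `K > 0` such that every refutation of degree at most `K n^{1/3}` has size at
least `⌊n^{1/6}⌋!`. -/
theorem nullstellensatz_exp_tradeoff :
    ∃ φ : ℕ → CNF,
      (∀ n, (φ n).Is3CNF ∧ (φ n).Unsat) ∧
      (∃ a b : ℝ, 0 < a ∧ 0 < b ∧ ∀ n : ℕ, 1 ≤ n →
        a * n ≤ ((φ n).nvars : ℝ) ∧ ((φ n).nvars : ℝ) ≤ b * n ∧
        a * n ≤ ((φ n).clauses.card : ℝ) ∧ ((φ n).clauses.card : ℝ) ≤ b * n) ∧
      ∀ (F : Type) [Field F],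
        -- (1) a refutation of degree O(n^{1/6} log n)
        (∃ C : ℝ, 0 < C ∧ ∃ N : ℕ, ∀ n : ℕ, N ≤ n →
          ∃ r s, IsNSCert ((φ n).polys F) r s ∧
            (nsDegree ((φ n).polys F) r s : ℝ) ≤
              C * (n : ℝ) ^ ((1 : ℝ) / 6) * Real.logb 2 n) ∧
        -- (2) a refutation of size O(n^{1+ε}) and degree O(n^{1/3} log n)
        (∀ ε : ℝ, 0 < ε → ∃ C : ℝ, 0 < C ∧ ∃ N : ℕ, ∀ n : ℕ, N ≤ n →
          ∃ r s, IsNSCert ((φ n).polys F) r s ∧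
            (nsSize ((φ n).polys F) r s : ℝ) ≤ C * (n : ℝ) ^ ((1 : ℝ) + ε) ∧
            (nsDegree ((φ n).polys F) r s : ℝ) ≤
              C * (n : ℝ) ^ ((1 : ℝ) / 3) * Real.logb 2 n) ∧
        -- (3) every refutation of degree at most K n^{1/3} has size at least ⌊n^{1/6}⌋!
        (∃ K : ℝ, 0 < K ∧ ∃ N : ℕ, ∀ n : ℕ, N ≤ n →
          ∀ r s, IsNSCert ((φ n).polys F) r s →
            (nsDegree ((φ n).polys F) r s : ℝ) ≤ K * (n : ℝ) ^ ((1 : ℝ) / 3) →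
            Nat.factorial ⌊(n : ℝ) ^ ((1 : ℝ) / 6)⌋₊ ≤ nsSize ((φ n).polys F) r s) := by
  refine ⟨fun n => peb ⌊(n : ℝ) ^ ((1 : ℝ) / 6)⌋₊, fun n => ⟨peb_3cnf _, peb_unsat _⟩, ?_, ?_⟩
  · refine ⟨1, 65, by norm_num, by norm_num, fun n hn => ?_⟩
    obtain ⟨y, hy, h1, h6, h3, hlt, hle⟩ := root_facts n hn
    have hn' : (1 : ℝ) ≤ n := by exact_mod_cast hn
    have e1 : y ^ 6 ≤ (⌊y⌋₊ + 1 : ℝ) ^ 6 := pow_le_pow_left₀ (by linarith) hlt.le 6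
    have e2 : (⌊y⌋₊ + 1 : ℝ) ^ 6 ≤ (2 * y) ^ 6 := pow_le_pow_left₀ (by positivity) hle 6
    rw [mul_pow, h6] at e2
    rw [h6] at e1
    have e3 : ((peb ⌊(n : ℝ) ^ ((1 : ℝ) / 6)⌋₊).nvars : ℝ) = (⌊y⌋₊ + 1 : ℝ) ^ 6 := by
      rw [← hy]
      change ((gN ⌊y⌋₊ : ℕ) : ℝ) = _
      rw [gN_eq]; push_cast; rfl
    have e4 : ((peb ⌊(n : ℝ) ^ ((1 : ℝ) / 6)⌋₊).clauses.card : ℝ) = (⌊y⌋₊ + 1 : ℝ) ^ 6 + 1 := by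
      rw [← hy, peb_clauses_card, gN_eq]; push_cast; rfl
    rw [e3, e4]
    refine ⟨?_, ?_, ?_, ?_⟩ <;> linarith
  intro F _
  refine ⟨?_, ?_, ?_⟩
  · exact ⟨6, by norm_num, 64, fun n hn => part1 F n _ hn rfl⟩
  · intro ε hε
    obtain ⟨C, hC, h⟩ := part2 F ε hε
    exact ⟨C, hC, 64, fun n hn => h n _ hn rfl⟩
  · exact ⟨1 / 4, by norm_num, 4096, fun n hn r s hcert hdeg => part3 F n _ hn rfl r s hcert hdeg⟩
end

section
/- Let δ > 0 be an arbitrary constant and let g : ℕ → ℕ be any monotone nondecreasing function with g(n) → ∞ and g(n) ≤ n^{1/4}. Then there is a family {F_n} of unsatisfiable 3-CNF formulas with Θ(n) clauses and variables such that, over any field F: (1) F_n has a Nullstellensatz refutation of degree at most g(n)·log n; (2) for every constant ε > 0, F_n has a Nullstellensatz refutation of size O(n^{1+ε}) and degree O(n^{1/2}·log n / g(n)); and (3) there is a constant K > 0 such that every Nullstellensatz refutation of F_n of degree at most K·n^{1/2−δ}/g(n) has size superpolynomial in n (i.e., for every constant k, the size exceeds n^k for all sufficiently large n). -/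
open MvPolynomial

/-! ### Reversible pebbling -/

/-- One move of the reversible pebble game (symmetric form). -/
def PAdj {W : Type} [DecidableEq W] (pred : W → Finset W) (P Q : Finset W) : Prop :=
  ∃ v, pred v ⊆ P ∧ pred v ⊆ Q ∧ insert v P = insert v Q

/-- Reachability in space `S` and time `T`. -/
inductive PReach {W : Type} [DecidableEq W] (pred : W → Finset W) (S : ℕ) :
    ℕ → Finset W → Finset W → Prop
  | refl (P : Finset W) (h : P.card ≤ S) : PReach pred S 0 P P
  | step {T : ℕ} {P Q Q' : Finset W} (h : PReach pred S T P Q) (ha : PAdj pred Q Q')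
      (hc : Q'.card ≤ S) : PReach pred S (T + 1) P Q'
  | idle {T : ℕ} {P Q : Finset W} (h : PReach pred S T P Q) : PReach pred S (T + 1) P Q

section Peb

variable {W : Type} [DecidableEq W] {pred : W → Finset W}

theorem PAdj.symm {P Q : Finset W} (h : PAdj pred P Q) : PAdj pred Q P := by
  obtain ⟨v, h1, h2, h3⟩ := h
  exact ⟨v, h2, h1, h3.symm⟩

theorem PAdj.frame {P Q : Finset W} (h : PAdj pred P Q) (R : Finset W) :
    PAdj pred (P ∪ R) (Q ∪ R) := by
  obtain ⟨v, h1, h2, h3⟩ := h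
  refine ⟨v, h1.trans Finset.subset_union_left, h2.trans Finset.subset_union_left, ?_⟩
  rw [← Finset.insert_union, ← Finset.insert_union, h3]

theorem PReach.card_left {S T : ℕ} {P Q : Finset W} (h : PReach pred S T P Q) : P.card ≤ S := by
  induction h with
  | refl P h => exact h
  | step h ha hc ih => exact ih
  | idle h ih => exact ih

theorem PReach.card_right {S T : ℕ} {P Q : Finset W} (h : PReach pred S T P Q) : Q.card ≤ S := by
  induction h with
  | refl P h => exact h
  | step h ha hc ih => exact hc
  | idle h ih => exact ih

theorem PReach.mono_space {S S' T : ℕ} {P Q : Finset W} (h : PReach pred S T P Q) (hS : S ≤ S') :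
    PReach pred S' T P Q := by
  induction h with
  | refl P h => exact .refl P (h.trans hS)
  | step h ha hc ih => exact .step ih ha (hc.trans hS)
  | idle h ih => exact .idle ih

theorem PReach.mono_time {S T T' : ℕ} {P Q : Finset W} (h : PReach pred S T P Q) (hT : T ≤ T') :
    PReach pred S T' P Q := by
  obtain ⟨d, rfl⟩ := Nat.exists_eq_add_of_le hT
  clear hT
  induction d with
  | zero => exact h
  | succ d ih => exact .idle ih

theorem PReach.mono {S S' T T' : ℕ} {P Q : Finset W} (h : PReach pred S T P Q) (hS : S ≤ S')
    (hT : T ≤ T') : PReach pred S' T' P Q := (h.mono_space hS).mono_time hT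

theorem PReach.trans {S T T' : ℕ} {P Q R : Finset W} (h : PReach pred S T P Q)
    (h' : PReach pred S T' Q R) : PReach pred S (T + T') P R := by
  induction h' with
  | refl P _ => exact h
  | step _ ha hc ih => exact .step (ih h) ha hc
  | idle _ ih => exact .idle (ih h)

theorem PReach.single {S : ℕ} {P Q : Finset W} (h : PAdj pred P Q) (hP : P.card ≤ S)
    (hQ : Q.card ≤ S) : PReach pred S 1 P Q := .step (.refl P hP) h hQ

theorem PReach.symm {S T : ℕ} {P Q : Finset W} (h : PReach pred S T P Q) :
    PReach pred S T Q P := by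
  induction h with
  | refl P h => exact .refl P h
  | step h ha hc ih =>
    have := (PReach.single ha.symm hc h.card_right).trans ih
    rwa [add_comm] at this
  | idle _ ih => exact .idle ih

theorem PReach.frame {S T : ℕ} {P Q : Finset W} (h : PReach pred S T P Q) (R : Finset W) :
    PReach pred (S + R.card) T (P ∪ R) (Q ∪ R) := by
  have key : ∀ {X : Finset W}, X.card ≤ S → (X ∪ R).card ≤ S + R.card := fun {X} hX =>
    (Finset.card_union_le _ _).trans (by omega)
  induction h with
  | refl P h => exact .refl _ (key h)
  | step h ha hc ih => exact .step ih (ha.frame R) (key hc)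
  | idle _ ih => exact .idle ih

/-- Divide-and-conquer reversible pebbling of a line of blocks. -/
theorem line_pebbling (A : ℕ → Finset W) (w o τ M : ℕ) (hA : ∀ j, (A j).card ≤ w)
    (ht : ∀ j < M, PReach pred o τ (A j) (A j ∪ A (j + 1))) :
    ∀ k p m, 1 ≤ m → m ≤ 2 ^ k → p + m ≤ M →
      PReach pred (o + k * w) (3 ^ k * τ) (A p) (A p ∪ A (p + m)) := by
  intro k
  induction k with
  | zero =>
    intro p m h1 h2 h3
    have : m = 1 := by simp at h2; omega
    subst this
    simpa using ht p (by omega)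
  | succ k ih =>
    intro p m h1 h2 h3
    by_cases hm : m ≤ 2 ^ k
    · refine (ih p m h1 hm h3).mono ?_ ?_
      · gcongr; omega
      · gcongr <;> omega
    · have hpos : 1 ≤ 2 ^ k := Nat.one_le_two_pow
      rw [pow_succ] at h2
      have a1 := ih p (2 ^ k) hpos le_rfl (by omega)
      have a2 := ih (p + 2 ^ k) (m - 2 ^ k) (by omega) (by omega) (by omega)
      have e : p + 2 ^ k + (m - 2 ^ k) = p + m := by omega
      rw [e] at a2
      have hs : ∀ j, o + k * w + (A j).card ≤ o + (k + 1) * w := fun j => by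
        have := hA j
        rw [Nat.succ_mul]; omega
      have b1 := a1.mono_space (le_trans (Nat.le_add_right _ _) (hs 0))
      have b2 := (a2.frame (A p)).mono_space (hs p)
      have b3 := (a1.symm.frame (A (p + m))).mono_space (hs (p + m))
      have e1 : A (p + 2 ^ k) ∪ A p = A p ∪ A (p + 2 ^ k) := Finset.union_comm _ _
      have e2 : A (p + 2 ^ k) ∪ A (p + m) ∪ A p = A p ∪ A (p + 2 ^ k) ∪ A (p + m) := by
        ext x; simp only [Finset.mem_union]; tauto
      rw [e1, e2] at b2
      refine ((b1.trans b2).trans b3).mono_time ?_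
      rw [pow_succ]; linarith

/-- The layered graph: `enc i a j` is position `j` of spine `a` at level `i`. -/
structure Layered (pred : W → Finset W) (enc : ℕ → ℕ → ℕ → W) (r c : ℕ) : Prop where
  inj : ∀ i a j a' j', i < r → a < c → j < c → a' < c → j' < c →
    enc i a j = enc i a' j' → a = a' ∧ j = j'
  mem : ∀ i a j, i < r → a < c → j < c → ∀ u, u ∈ pred (enc i a j) ↔
    (0 < j ∧ u = enc i a (j - 1)) ∨ (0 < i ∧ u = enc (i - 1) j (c - 1))

theorem padj_insert {P : Finset W} (v : W) (h : pred v ⊆ P) : PAdj pred P (P ∪ {v}) := by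
  refine ⟨v, h, h.trans Finset.subset_union_left, ?_⟩
  ext x; simp

/-- Low-space strategy. -/
theorem low_space {enc : ℕ → ℕ → ℕ → W} {r c : ℕ} (H : Layered pred enc r c) (hc : 1 ≤ c)
    (k : ℕ) (hk : c ≤ 2 ^ k) : ∀ i, i < r → ∃ T, ∀ a < c,
      PReach pred ((i + 1) * (k + 2)) T ∅ {enc i a (c - 1)} := by
  have main : ∀ i, i < r → ∀ a < c, ∀ o τ, (∀ j < c,
      PReach pred o τ (if j = 0 then ∅ else {enc i a (j - 1)})
        ((if j = 0 then ∅ else {enc i a (j - 1)}) ∪ {enc i a j})) →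
      PReach pred (o + k * 1) (3 ^ k * τ) ∅ {enc i a (c - 1)} := by
    intro i hi a ha o τ hj
    have := line_pebbling (pred := pred) (fun j => if j = 0 then ∅ else {enc i a (j - 1)}) 1 o τ c
      (by intro j; split_ifs <;> simp)
      (by intro j hjc; simpa using hj j hjc) k 0 c hc hk (by omega)
    have hc0 : c ≠ 0 := by omega
    simpa [hc0] using this
  intro i
  induction i with
  | zero =>
    intro hi
    refine ⟨3 ^ k * 1, fun a ha => (main 0 hi a ha 2 1 ?_).mono_space (by omega)⟩
    intro j hj
    refine PReach.single (padj_insert _ ?_) ?_ ?_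
    · intro u hu
      rw [H.mem 0 a j hi ha hj] at hu
      rcases hu with ⟨h, rfl⟩ | ⟨h, _⟩
      · have : j ≠ 0 := by omega
        simp [this]
      · omega
    · split_ifs <;> simp
    · refine (Finset.card_union_le _ _).trans ?_
      split_ifs <;> simp
  | succ i ih =>
    intro hi
    obtain ⟨T, hT⟩ := ih (by omega)
    refine ⟨3 ^ k * (T + 1 + T), fun a ha =>
      (main (i + 1) hi a ha ((i + 1) * (k + 2) + 2) (T + 1 + T) ?_).mono_space (by linarith)⟩
    intro j hj
    set A : Finset W := if j = 0 then ∅ else {enc (i + 1) a (j - 1)} with hA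
    have hAc : A.card ≤ 1 := by rw [hA]; split_ifs <;> simp
    have h1 := (hT j hj).frame A
    have h3 := (hT j hj).symm.frame (A ∪ {enc (i + 1) a j})
    have hc2 : (A ∪ {enc (i + 1) a j}).card ≤ 2 :=
      (Finset.card_union_le _ _).trans (by simp; omega)
    have h2 : PAdj pred ({enc i j (c - 1)} ∪ A) ({enc i j (c - 1)} ∪ A ∪ {enc (i + 1) a j}) := by
      refine padj_insert _ ?_
      intro u hu
      rw [H.mem (i + 1) a j hi ha hj] at hu
      rcases hu with ⟨h, rfl⟩ | ⟨h, rfl⟩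
      · have : j ≠ 0 := by omega
        simp [hA, this]
      · simp
    rw [Finset.empty_union] at h1 h3
    rw [← Finset.union_assoc] at h3
    have hup := h1.mono_space (show _ ≤ (i + 1) * (k + 2) + 2 by omega)
    have hdown := h3.mono_space (show _ ≤ (i + 1) * (k + 2) + 2 by omega)
    exact (hup.trans (PReach.single h2 hup.card_right hdown.card_left)).trans hdown

/-- Fast strategy. -/
theorem fast {enc : ℕ → ℕ → ℕ → W} {r c : ℕ} (H : Layered pred enc r c) (hc : 1 ≤ c)
    (hr : 1 ≤ r) (k : ℕ) (hk : r ≤ 2 ^ k) :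
    ∃ Q, enc (r - 1) 0 (c - 1) ∈ Q ∧
      PReach pred (3 * c + k * c) (3 ^ k * (c * (2 * c))) ∅ Q := by
  let row : ℕ → ℕ → Finset W := fun i b => (Finset.range b).image fun a => enc i a (c - 1)
  let B : ℕ → Finset W := fun i => if i = 0 then ∅ else row (i - 1) c
  have hrow : ∀ i b, (row i b).card ≤ b := fun i b =>
    Finset.card_image_le.trans (by simp)
  have hB : ∀ i, (B i).card ≤ c := by
    intro i; dsimp only [B]; split_ifs
    · simp
    · exact hrow _ _
  have tog : ∀ i < r, PReach pred (3 * c) (c * (2 * c)) (B i) (B i ∪ B (i + 1)) := by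
    intro i hi
    let sp : ℕ → ℕ → Finset W := fun a b => (Finset.range b).image fun j => enc i a j
    have hsp : ∀ a b, (sp a b).card ≤ b := fun a b => Finset.card_image_le.trans (by simp)
    have hsps : ∀ a b, sp a (b + 1) = sp a b ∪ {enc i a b} := by
      intro a b; ext x
      simp only [sp, Finset.range_add_one, Finset.image_insert, Finset.mem_insert, Finset.mem_union,
        Finset.mem_singleton]
      tauto
    have hrows : ∀ b, row i (b + 1) = row i b ∪ {enc i b (c - 1)} := by
      intro b; ext x
      simp only [row, Finset.range_add_one, Finset.image_insert, Finset.mem_insert,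
        Finset.mem_union, Finset.mem_singleton]
      tauto
    have up : ∀ a < c, ∀ b ≤ c, PReach pred (2 * c) b (B i) (B i ∪ sp a b) := by
      intro a ha b
      induction b with
      | zero =>
        intro _
        have : B i ∪ sp a 0 = B i := by simp [sp]
        rw [this]
        exact .refl _ (by have := hB i; omega)
      | succ b ih =>
        intro hb
        refine .step (ih (by omega)) ?_ ?_
        · rw [hsps, ← Finset.union_assoc]
          refine padj_insert _ ?_
          intro u hu
          rw [H.mem i a b hi ha (by omega)] at hu
          rcases hu with ⟨h, rfl⟩ | ⟨h, rfl⟩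
          · refine Finset.mem_union_right _ (Finset.mem_image.2 ⟨b - 1, ?_, rfl⟩)
            simp; omega
          · refine Finset.mem_union_left _ ?_
            have : i ≠ 0 := by omega
            simp only [B, this, if_false]
            exact Finset.mem_image.2 ⟨b, by simp; omega, rfl⟩
        · refine (Finset.card_union_le _ _).trans ?_
          have := hB i; have := hsp a (b + 1); omega
    have one : ∀ a < c, PReach pred (2 * c) (2 * c) (B i) (B i ∪ {enc i a (c - 1)}) := by
      intro a ha
      have h1 := up a ha c le_rfl
      obtain ⟨d, rfl⟩ : ∃ d, c = d + 1 := ⟨c - 1, by omega⟩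
      have h2 : PReach pred (2 * (d + 1)) d (B i ∪ {enc i a d}) (B i ∪ sp a d ∪ {enc i a d}) := by
        have key : ∀ b ≤ d, PReach pred (2 * (d + 1)) b (B i ∪ {enc i a d})
            (B i ∪ sp a b ∪ {enc i a d}) := by
          intro b
          induction b with
          | zero =>
            intro _
            have : B i ∪ sp a 0 ∪ {enc i a d} = B i ∪ {enc i a d} := by simp [sp]
            rw [this]
            refine .refl _ ((Finset.card_union_le _ _).trans ?_)
            have := hB i; simp; omega
          | succ b ih =>
            intro hb
            refine .step (ih (by omega)) ?_ ?_
            · rw [hsps, ← Finset.union_assoc]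
              refine PAdj.frame (padj_insert _ ?_) _
              intro u hu
              rw [H.mem i a b hi ha (by omega)] at hu
              rcases hu with ⟨h, rfl⟩ | ⟨h, rfl⟩
              · refine Finset.mem_union_right _ (Finset.mem_image.2 ⟨b - 1, ?_, rfl⟩)
                simp; omega
              · refine Finset.mem_union_left _ ?_
                have : i ≠ 0 := by omega
                simp only [B, this, if_false]
                exact Finset.mem_image.2 ⟨b, by simp; omega, rfl⟩
            · refine (Finset.card_union_le _ _).trans ?_
              have h1 := hB i; have h2 := hsp a (b + 1)
              have h3 := Finset.card_union_le (B i) (sp a (b + 1))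
              simp; omega
        exact key d le_rfl
      rw [hsps, ← Finset.union_assoc] at h1
      exact (h1.trans h2.symm).mono_time (by omega)
    have all : ∀ b ≤ c, PReach pred (3 * c) (b * (2 * c)) (B i) (B i ∪ row i b) := by
      intro b
      induction b with
      | zero =>
        intro _
        have : B i ∪ row i 0 = B i := by simp [row]
        rw [this, zero_mul]
        exact .refl _ (by have := hB i; omega)
      | succ b ih =>
        intro hb
        have h1 := (one b (by omega)).frame (row i b)
        have h1' := h1.mono_space (show _ ≤ 3 * c by have := hrow i b; omega)
        have e : B i ∪ {enc i b (c - 1)} ∪ row i b = B i ∪ row i (b + 1) := by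
          rw [hrows, Finset.union_assoc, Finset.union_comm {_}]
        rw [e] at h1'
        have e2 : (b + 1) * (2 * c) = b * (2 * c) + 2 * c := Nat.succ_mul _ _
        rw [e2]
        exact (ih (by omega)).trans h1'
    have := all c le_rfl
    have e : B (i + 1) = row i c := by simp [B]
    rwa [e]
  have := line_pebbling B c (3 * c) (c * (2 * c)) r hB tog k 0 r hr hk (by omega)
  refine ⟨_, ?_, by simpa [B] using this⟩
  have hr0 : r ≠ 0 := by omega
  simp only [hr0, if_false, row]
  exact Finset.mem_image.2 ⟨0, by simp; omega, rfl⟩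

/-- Lower bound on pebbling time in bounded space. -/
theorem pebbling_lower {enc : ℕ → ℕ → ℕ → W} {r c : ℕ} (H : Layered pred enc r c) (hc : 1 ≤ c)
    (s : ℕ) (P : ℕ → Finset W) (T : ℕ) (hP : ∀ t ≤ T, (P t).card ≤ s)
    (hadj : ∀ t < T, PAdj pred (P t) (P (t + 1))) :
    ∀ i < r, ∀ a < c, ∀ t0 t1, t0 ≤ t1 → t1 ≤ T → (∀ j < c, enc i a j ∉ P t0) →
      enc i a (c - 1) ∈ P t1 → t0 + (c / (s + 1)) ^ i ≤ t1 := by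
  intro i
  induction i with
  | zero =>
    intro hi a ha t0 t1 h01 h1T hemp hmem
    rcases h01.lt_or_eq with h | h
    · simp; omega
    · subst h
      exact absurd hmem (hemp _ (by omega))
  | succ i ih =>
    intro hi a ha t0 t1 h01 h1T hemp hmem
    -- placing a pebble requires predecessors
    have place : ∀ t w, t < T → w ∉ P t → w ∈ P (t + 1) → pred w ⊆ P t ∧ pred w ⊆ P (t + 1) := by
      intro t w ht h1 h2
      obtain ⟨v, p1, p2, p3⟩ := hadj t ht
      have : w = v := by
        have h3 : w ∈ insert v (P t) := by rw [p3]; exact Finset.mem_insert_of_mem h2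
        rcases Finset.mem_insert.1 h3 with h | h
        · exact h
        · exact absurd h h1
      subst this
      exact ⟨p1, p2⟩
    -- first times
    have first : ∀ j < c, (∃ t, t0 ≤ t ∧ t ≤ t1 ∧ enc (i + 1) a j ∈ P t) →
        ∃ t, t0 ≤ t ∧ t < t1 ∧ enc (i + 1) a j ∈ P (t + 1) ∧ pred (enc (i + 1) a j) ⊆ P t ∧
          pred (enc (i + 1) a j) ⊆ P (t + 1) ∧
          ∀ t', t0 ≤ t' → t' ≤ t → enc (i + 1) a j ∉ P t' := by
      intro j hj hex
      classical
      have hspec := Nat.find_spec hex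
      have hmin := fun m => Nat.find_min (H := hex) (m := m)
      set f := Nat.find hex
      have hne : f ≠ t0 := fun h => hemp j hj (h ▸ hspec.2.2)
      obtain ⟨t, ht⟩ : ∃ t, f = t + 1 := ⟨f - 1, by omega⟩
      rw [ht] at hspec hmin
      have hnot : ∀ t', t0 ≤ t' → t' ≤ t → enc (i + 1) a j ∉ P t' := by
        intro t' h1 h2 h3
        exact hmin t' (by omega) ⟨h1, by omega, h3⟩
      have := place t _ (by omega) (hnot t (by omega) le_rfl) hspec.2.2
      exact ⟨t, by omega, by omega, hspec.2.2, this.1, this.2, hnot⟩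
    have exall : ∀ d j, j + d = c - 1 → ∃ t, t0 ≤ t ∧ t ≤ t1 ∧ enc (i + 1) a j ∈ P t := by
      intro d
      induction d with
      | zero =>
        intro j hj
        have : j = c - 1 := by omega
        subst this
        exact ⟨t1, h01, le_rfl, hmem⟩
      | succ d ihd =>
        intro j hj
        obtain ⟨t, h1, h2, h3, h4, h5, h6⟩ := first (j + 1) (by omega) (ihd (j + 1) (by omega))
        refine ⟨t, h1, h2.le, h4 ?_⟩
        rw [H.mem (i + 1) a (j + 1) hi ha (by omega)]
        exact Or.inl ⟨by omega, rfl⟩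
    have hτ : ∀ j, ∃ t, j < c → t0 ≤ t ∧ t < t1 ∧ enc (i + 1) a j ∈ P (t + 1) ∧
          pred (enc (i + 1) a j) ⊆ P t ∧ pred (enc (i + 1) a j) ⊆ P (t + 1) ∧
          ∀ t', t0 ≤ t' → t' ≤ t → enc (i + 1) a j ∉ P t' := by
      intro j
      by_cases hj : j < c
      · obtain ⟨t, ht⟩ := first j hj (exall (c - 1 - j) j (by omega))
        exact ⟨t, fun _ => ht⟩
      · exact ⟨0, fun h => absurd h hj⟩
    choose τ hτ using hτ
    have hlt : ∀ j, j + 1 < c → τ j < τ (j + 1) := by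
      intro j hj
      obtain ⟨h1, h2, h3, h4, h5, h6⟩ := hτ (j + 1) hj
      obtain ⟨g1, g2, g3, g4, g5, g6⟩ := hτ j (by omega)
      by_contra hcon
      refine g6 (τ (j + 1)) h1 (by omega) (h4 ?_)
      rw [H.mem (i + 1) a (j + 1) hi ha hj]
      exact Or.inl ⟨by omega, rfl⟩
    have hmono : ∀ d j, j + d < c → τ j + d ≤ τ (j + d) := by
      intro d
      induction d with
      | zero => intro j _; simp
      | succ d ihd =>
        intro j hj
        have := ihd j (by omega)
        have := hlt (j + d) (by omega)
        have e : j + (d + 1) = j + d + 1 := by omega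
        rw [e]
        omega
    have hz : ∀ j < c, enc i j (c - 1) ∈ P (τ j) := by
      intro j hj
      obtain ⟨h1, h2, h3, h4, h5, h6⟩ := hτ j hj
      apply h4
      rw [H.mem (i + 1) a j hi ha hj]
      exact Or.inr ⟨by omega, by simp⟩
    have window : ∀ j, j + s < c → τ j + (c / (s + 1)) ^ i ≤ τ (j + s) := by
      intro j hj
      -- some spine among j..j+s is empty at time τ j
      have hbd := (hτ j (by omega))
      have : ∃ d ≤ s, ∀ y < c, enc i (j + d) y ∉ P (τ j) := by
        by_contra hcon
        push Not at hcon
        choose y hy1 hy2 using hcon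
        have hcard : (Finset.range (s + 1)).card ≤ (P (τ j)).card := by
          refine Finset.card_le_card_of_injOn
            (fun d => if h : d ≤ s then enc i (j + d) (y d h) else enc i 0 0) ?_ ?_
          · intro d hd
            have hd' : d ≤ s := by simpa [Nat.lt_succ_iff] using hd
            simpa [hd'] using hy2 d hd'
          · intro d hd d' hd' heq
            have h1 : d ≤ s := by simpa [Nat.lt_succ_iff] using hd
            have h2 : d' ≤ s := by simpa [Nat.lt_succ_iff] using hd'
            simp only [h1, h2, dif_pos] at heq
            have := (H.inj i _ _ _ _ (by omega) (by omega) (hy1 d h1) (by omega) (hy1 d' h2) heq).1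
            omega
        have := hP (τ j) (by omega)
        simp at hcard
        omega
      obtain ⟨d, hd, hdy⟩ := this
      have m1 := hmono d j (by omega)
      have m2 := hmono (s - d) (j + d) (by omega)
      have e : j + d + (s - d) = j + s := by omega
      rw [e] at m2
      have hb2 := hτ (j + d) (by omega)
      have := ih (by omega) (j + d) (by omega) (τ j) (τ (j + d)) (by omega) (by omega) hdy
        (hz (j + d) (by omega))
      omega
    have groups : ∀ l, 1 ≤ l → l * (s + 1) ≤ c →
        t0 + l * (c / (s + 1)) ^ i ≤ τ (l * (s + 1) - 1) := by
      intro l hl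
      induction l, hl using Nat.le_induction with
      | base =>
        intro h
        have := window 0 (by omega)
        have h0 := hτ 0 (by omega)
        simp at this ⊢
        omega
      | succ l hl ihl =>
        intro h
        rw [Nat.succ_mul] at h
        have hpos : 1 ≤ l * (s + 1) := Nat.mul_pos hl (by omega)
        have g1 := ihl (by omega)
        have g2 := hmono 1 (l * (s + 1) - 1) (by omega)
        have g3 := window (l * (s + 1)) (by omega)
        have e1 : l * (s + 1) - 1 + 1 = l * (s + 1) := by omega
        rw [e1] at g2
        have e2 : (l + 1) * (s + 1) - 1 = l * (s + 1) + s := by rw [Nat.succ_mul]; omega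
        rw [e2, Nat.add_mul, one_mul]
        omega
    by_cases hq : c / (s + 1) = 0
    · rw [hq]; simpa using h01
    · have hq1 : 1 ≤ c / (s + 1) := Nat.one_le_iff_ne_zero.2 hq
      have h1 := groups (c / (s + 1)) hq1 (Nat.div_mul_le_self _ _)
      have hle := Nat.div_mul_le_self c (s + 1)
      have hpos : 1 ≤ c / (s + 1) * (s + 1) := Nat.mul_pos hq1 (by omega)
      have h2 := hτ (c / (s + 1) * (s + 1) - 1) (by omega)
      rw [pow_succ, mul_comm]
      omega

end Peb
/-! ### Pebbling formulas and the Nullstellensatz -/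

section NS

/-- The clauses of the pebbling formula. -/
def pcl {N : ℕ} (pred : Fin N → Finset (Fin N)) (t : Fin N) : Option (Fin N) → Clause N
  | none => (∅, {t})
  | some v => ({v}, pred v)

/-- The pebbling formula. -/
abbrev pebCNF (N : ℕ) (pred : Fin N → Finset (Fin N)) (t : Fin N) : CNF where
  nvars := N
  clauses := Finset.univ.image (pcl pred t)

variable {N : ℕ} (pred : Fin N → Finset (Fin N)) (t : Fin N)

theorem pcl_injective : Function.Injective (pcl pred t) := by
  intro a b h
  cases a with
  | none =>
    cases b with
    | none => rfl
    | some b => simp [pcl] at h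
  | some a =>
    cases b with
    | none => simp [pcl] at h
    | some b => simp [pcl] at h; simp [h.1]

theorem pebCNF_card : (pebCNF N pred t).clauses.card = N + 1 := by
  simp [pebCNF, Finset.card_image_of_injective _ (pcl_injective pred t)]

/-- Indexing of the clauses. -/
noncomputable def pidx : Option (Fin N) ≃ {C // C ∈ (pebCNF N pred t).clauses} :=
  Equiv.ofBijective (fun o => ⟨pcl pred t o, Finset.mem_image_of_mem _ (Finset.mem_univ _)⟩) (by
    constructor
    · intro a b h
      exact pcl_injective pred t (Subtype.ext_iff.1 h)
    · rintro ⟨C, hC⟩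
      obtain ⟨o, _, ho⟩ := Finset.mem_image.1 hC
      exact ⟨o, Subtype.ext ho⟩)

variable (F : Type) [Field F]

/-- The polynomial of a vertex axiom. -/
noncomputable def qv (v : Fin N) : MvPolynomial (Fin N) F := (1 - X v) * ∏ u ∈ pred v, X u

theorem polys_none : (pebCNF N pred t).polys F (pidx pred t none) = X t := by
  show Clause.poly F (pcl pred t none) = X t
  simp [Clause.poly, pcl]

theorem polys_some (v : Fin N) :
    (pebCNF N pred t).polys F (pidx pred t (some v)) = qv pred F v := by
  show Clause.poly F (pcl pred t (some v)) = _
  simp [Clause.poly, pcl, qv]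

variable {F}

theorem cert_iff (r : {C // C ∈ (pebCNF N pred t).clauses} → MvPolynomial (Fin N) F)
    (s : Fin N → MvPolynomial (Fin N) F) :
    IsNSCert ((pebCNF N pred t).polys F) r s ↔
      r (pidx pred t none) * X t + ∑ v, r (pidx pred t (some v)) * qv pred F v +
        ∑ j, s j * (X j ^ 2 - X j) = 1 := by
  have h : ∑ i, r i * (pebCNF N pred t).polys F i =
      r (pidx pred t none) * X t + ∑ v, r (pidx pred t (some v)) * qv pred F v := by
    rw [← Equiv.sum_comp (pidx pred t), Fintype.sum_option, polys_none]
    exact congrArg₂ (· + ·) rfl (Finset.sum_congr rfl fun v _ => by rw [polys_some])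
  unfold IsNSCert
  exact Eq.congr_left (congrArg₂ (· + ·) h rfl)

theorem size_eq (r : {C // C ∈ (pebCNF N pred t).clauses} → MvPolynomial (Fin N) F)
    (s : Fin N → MvPolynomial (Fin N) F) :
    nsSize ((pebCNF N pred t).polys F) r s =
      (r (pidx pred t none)).support.card * (X t : MvPolynomial (Fin N) F).support.card +
      ∑ v, (r (pidx pred t (some v))).support.card * (qv pred F v).support.card +
        ∑ j, 2 * (s j).support.card := by
  have h : ∑ i, (r i).support.card * ((pebCNF N pred t).polys F i).support.card =
      (r (pidx pred t none)).support.card * (X t : MvPolynomial (Fin N) F).support.card +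
      ∑ v, (r (pidx pred t (some v))).support.card * (qv pred F v).support.card := by
    rw [← Equiv.sum_comp (pidx pred t), Fintype.sum_option, polys_none]
    exact congrArg₂ (· + ·) rfl (Finset.sum_congr rfl fun v _ => by rw [polys_some])
  unfold nsSize
  exact congrArg₂ (· + ·) h rfl

theorem prodX (P : Finset (Fin N)) :
    ∏ u ∈ P, (X u : MvPolynomial (Fin N) F) = monomial (∑ u ∈ P, Finsupp.single u 1) 1 := by
  rw [monomial_sum_one]; rfl

theorem prodX_degree (P : Finset (Fin N)) :
    (∏ u ∈ P, (X u : MvPolynomial (Fin N) F)).totalDegree ≤ P.card := by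
  refine (totalDegree_finsetProd _ _).trans ?_
  simp [totalDegree_X]

theorem prodX_card (P : Finset (Fin N)) :
    (∏ u ∈ P, (X u : MvPolynomial (Fin N) F)).support.card ≤ 1 := by
  rw [prodX]
  exact (Finset.card_le_card support_monomial_subset).trans (by simp)

theorem qv_eq (v : Fin N) : qv pred F v =
    monomial (∑ u ∈ pred v, Finsupp.single u 1) 1 -
      monomial (∑ u ∈ pred v, Finsupp.single u 1 + Finsupp.single v 1) 1 := by
  rw [qv, prodX, sub_mul, one_mul, mul_comm (X v)]
  congr 1
  rw [X, monomial_mul, one_mul]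

theorem qv_card (v : Fin N) : (qv pred F v).support.card ≤ 2 := by
  classical
  rw [qv_eq]
  refine (Finset.card_le_card (support_sub _ _ _)).trans
    ((Finset.card_union_le _ _).trans ?_)
  have h : ∀ m : Fin N →₀ ℕ, (monomial m (1 : F)).support.card ≤ 1 := fun m =>
    (Finset.card_le_card support_monomial_subset).trans (by simp)
  exact Nat.add_le_add (h _) (h _)

theorem qv_ne_zero (v : Fin N) : qv pred F v ≠ 0 := by
  refine mul_ne_zero ?_ (Finset.prod_ne_zero_iff.2 fun u _ => X_ne_zero u)
  intro h
  have := congrArg (eval (fun _ => (0 : F))) h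
  simp at this

theorem adj_poly {S : ℕ} {P Q : Finset (Fin N)} (h : PAdj pred P Q) (hP : P.card ≤ S)
    (hQ : Q.card ≤ S) : ∃ v, ∃ m : MvPolynomial (Fin N) F,
      (∏ u ∈ P, X u) - (∏ u ∈ Q, X u) = m * qv pred F v ∧ m.support.card ≤ 1 ∧
      (m * qv pred F v).totalDegree ≤ S := by
  obtain ⟨v, h1, h2, h3⟩ := h
  have hdeg : ((∏ u ∈ P, X u) - (∏ u ∈ Q, X u) : MvPolynomial (Fin N) F).totalDegree ≤ S :=
    (totalDegree_sub _ _).trans (max_le ((prodX_degree P).trans hP) ((prodX_degree Q).trans hQ))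
  suffices ∃ m : MvPolynomial (Fin N) F,
      (∏ u ∈ P, X u) - (∏ u ∈ Q, X u) = m * qv pred F v ∧ m.support.card ≤ 1 by
    obtain ⟨m, e, hm⟩ := this
    exact ⟨v, m, e, hm, e ▸ hdeg⟩
  have aux : ∀ R : Finset (Fin N), pred v ⊆ R → v ∉ R →
      (∏ u ∈ R, X u) - (∏ u ∈ insert v R, X u) =
        (∏ u ∈ R \ pred v, (X u : MvPolynomial (Fin N) F)) * qv pred F v := by
    intro R hR hv
    rw [Finset.prod_insert hv, ← Finset.prod_sdiff hR, qv]
    ring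
  by_cases hvP : v ∈ P
  · rw [Finset.insert_eq_of_mem hvP] at h3
    by_cases hvQ : v ∈ Q
    · rw [Finset.insert_eq_of_mem hvQ] at h3
      exact ⟨0, by rw [h3]; simp, by simp⟩
    · refine ⟨-∏ u ∈ Q \ pred v, X u, ?_, ?_⟩
      · rw [h3, neg_mul, ← aux Q h2 hvQ]; ring
      · rw [support_neg]; exact prodX_card _
  · by_cases hvQ : v ∈ Q
    · rw [Finset.insert_eq_of_mem hvQ] at h3
      exact ⟨∏ u ∈ P \ pred v, X u, by rw [← h3, aux P h1 hvP], prodX_card _⟩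
    · have : P = Q := by
        have := congrArg (fun R => R.erase v) h3
        simpa [Finset.erase_insert hvP, Finset.erase_insert hvQ] using this
      exact ⟨0, by rw [this]; simp, by simp⟩

theorem reach_poly {S T : ℕ} {P Q : Finset (Fin N)} (h : PReach pred S T P Q) :
    ∃ ρ : Fin N → MvPolynomial (Fin N) F,
      (∏ u ∈ P, X u) - (∏ u ∈ Q, X u) = ∑ v, ρ v * qv pred F v ∧
      ∑ v, (ρ v).support.card ≤ T ∧ ∀ v, (ρ v * qv pred F v).totalDegree ≤ S := by
  classical
  induction h with
  | refl P h => exact ⟨0, by simp, by simp, by simp⟩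
  | idle h ih =>
    obtain ⟨ρ, h1, h2, h3⟩ := ih
    exact ⟨ρ, h1, by omega, h3⟩
  | @step T P Q Q' h ha hc ih =>
    obtain ⟨ρ, h1, h2, h3⟩ := ih
    obtain ⟨v, m, e, hm, hd⟩ := adj_poly (F := F) pred ha h.card_right hc
    refine ⟨ρ + Pi.single v m, ?_, ?_, ?_⟩
    · have : ∑ w, (ρ + Pi.single v m : Fin N → MvPolynomial (Fin N) F) w * qv pred F w =
          ∑ w, ρ w * qv pred F w + m * qv pred F v := by
        simp only [Pi.add_apply, add_mul, Finset.sum_add_distrib]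
        congr 1
        rw [Finset.sum_eq_single v]
        · simp
        · intro b _ hb; simp [hb]
        · simp
      rw [this, ← h1, ← e]; ring
    · have hle : ∀ w, ((ρ + Pi.single v m : Fin N → MvPolynomial (Fin N) F) w).support.card ≤
          (ρ w).support.card + if w = v then 1 else 0 := by
        intro w
        refine (Finset.card_le_card support_add).trans ((Finset.card_union_le _ _).trans ?_)
        gcongr
        by_cases hw : w = v
        · subst hw; simpa using hm
        · simp [hw]
      refine (Finset.sum_le_sum fun w _ => hle w).trans ?_
      rw [Finset.sum_add_distrib]
      simpa using h2
    · intro w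
      rw [Pi.add_apply, add_mul]
      refine (totalDegree_add _ _).trans (max_le (h3 w) ?_)
      by_cases hw : w = v
      · subst hw; simpa using hd
      · simp [hw]

/-- A pebbling strategy gives a Nullstellensatz refutation. -/
theorem ns_upper {S T : ℕ} {Q : Finset (Fin N)} (h : PReach pred S T ∅ Q) (ht : t ∈ Q)
    (F : Type) [Field F] :
    ∃ r s, IsNSCert ((pebCNF N pred t).polys F) r s ∧
      nsSize ((pebCNF N pred t).polys F) r s ≤ 2 * T + 1 ∧
      nsDegree ((pebCNF N pred t).polys F) r s ≤ S := by
  classical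
  obtain ⟨ρ, h1, h2, h3⟩ := reach_poly (F := F) pred h
  let r : {C // C ∈ (pebCNF N pred t).clauses} → MvPolynomial (Fin N) F := fun C =>
    ((pidx pred t).symm C).elim (∏ u ∈ Q.erase t, X u) ρ
  have r0 : r (pidx pred t none) = ∏ u ∈ Q.erase t, X u := by simp [r]
  have r1 : ∀ v, r (pidx pred t (some v)) = ρ v := by intro v; simp [r]
  have hQ : (∏ u ∈ Q.erase t, X u) * X t = ∏ u ∈ Q, (X u : MvPolynomial (Fin N) F) :=
    Finset.prod_erase_mul _ _ ht
  refine ⟨r, (fun _ => 0 : Fin N → MvPolynomial (Fin N) F), ?_, ?_, ?_⟩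
  · rw [cert_iff, r0]
    simp only [r1]
    rw [hQ, ← h1]; simp
  · rw [size_eq, r0]
    simp only [r1]
    have a1 : (∏ u ∈ Q.erase t, (X u : MvPolynomial (Fin N) F)).support.card *
        (X t : MvPolynomial (Fin N) F).support.card ≤ 1 := by
      rw [support_X]; simpa using prodX_card _
    have a2 : ∑ v, (ρ v).support.card * (qv pred F v).support.card ≤ 2 * T := by
      refine le_trans (Finset.sum_le_sum fun v _ => Nat.mul_le_mul_left _ (qv_card pred v)) ?_
      rw [← Finset.sum_mul]; omega
    simp only [support_zero, Finset.card_empty, mul_zero, Finset.sum_const_zero]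
    omega
  · unfold nsDegree
    refine max_le (Finset.sup_le fun C _ => ?_) (Finset.sup_le fun C _ => ?_)
    · obtain ⟨o, rfl⟩ := (pidx pred t).surjective C
      cases o with
      | none =>
        rw [r0, polys_none]
        refine le_trans (le_of_eq (congrArg totalDegree hQ)) ((prodX_degree Q).trans h.card_right)
      | some v => rw [r1, polys_some]; exact h3 v
    · rw [zero_mul, totalDegree_zero]; exact Nat.zero_le _

/-- Soundness. -/
theorem unsat_of_cert {S T : ℕ} {Q : Finset (Fin N)} (h : PReach pred S T ∅ Q) (ht : t ∈ Q) :
    (pebCNF N pred t).Unsat := by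
  intro a
  by_contra hcon
  push Not at hcon
  have hs : ∀ v, pred v ⊆ Finset.univ.filter (fun u => a u = true) → a v = true := by
    intro v hv
    have := hcon (pcl pred t (some v)) (Finset.mem_image_of_mem _ (Finset.mem_univ _))
    rcases this with ⟨x, hx, hx2⟩ | ⟨y, hy, hy2⟩
    · rw [Finset.mem_singleton.1 hx] at hx2; exact hx2
    · have := hv hy
      simp at this
      rw [this] at hy2; simp at hy2
  have ht' : a t = false := by
    have := hcon (pcl pred t none) (Finset.mem_image_of_mem _ (Finset.mem_univ _))
    rcases this with ⟨x, hx, hx2⟩ | ⟨y, hy, hy2⟩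
    · simp [pcl] at hx
    · rw [Finset.mem_singleton.1 hy] at hy2; exact hy2
  have key : ∀ {P Q : Finset (Fin N)} {T : ℕ}, PReach pred S T P Q →
      (∀ u ∈ P, a u = true) → ∀ u ∈ Q, a u = true := by
    intro P Q T h
    induction h with
    | refl P h => exact fun h => h
    | idle h ih => exact ih
    | step h ha hc ih =>
      intro hP u hu
      obtain ⟨v, h1, h2, h3⟩ := ha
      have hu' : u ∈ insert v _ := h3 ▸ Finset.mem_insert_of_mem hu
      rcases Finset.mem_insert.1 hu' with rfl | h
      · exact hs _ fun x hx => by simpa using ih hP x (h1 hx)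
      · exact ih hP u h
  have := key h (by simp) t ht
  rw [ht'] at this
  simp at this

/-- A Nullstellensatz refutation gives a pebbling. -/
theorem ns_lower (hpred : ∀ v, (pred v).card ≤ 2)
    (r : {C // C ∈ (pebCNF N pred t).clauses} → MvPolynomial (Fin N) F)
    (s : Fin N → MvPolynomial (Fin N) F) (h : IsNSCert ((pebCNF N pred t).polys F) r s) :
    ∃ (P : ℕ → Finset (Fin N)) (T : ℕ), P 0 = ∅ ∧ t ∈ P T ∧
      (∀ k ≤ T, (P k).card ≤ nsDegree ((pebCNF N pred t).polys F) r s + 3) ∧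
      (∀ k < T, PAdj pred (P k) (P (k + 1))) ∧
      T ≤ nsSize ((pebCNF N pred t).polys F) r s := by
  classical
  set D := nsDegree ((pebCNF N pred t).polys F) r s with hD
  let ρ : Fin N → MvPolynomial (Fin N) F := fun v => r (pidx pred t (some v))
  let E : Finset (Sym2 (Finset (Fin N))) := Finset.univ.biUnion fun v =>
    (ρ v).support.image fun m => s(m.support ∪ pred v, insert v (m.support ∪ pred v))
  let G : SimpleGraph (Finset (Fin N)) := SimpleGraph.fromEdgeSet (E : Set _)
  -- degrees
  have hdegρ : ∀ v, ∀ m ∈ (ρ v).support, m.support.card ≤ D := by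
    intro v m hm
    have h1 : m.support.card ≤ (ρ v).totalDegree := by
      refine le_trans ?_ (le_totalDegree hm)
      rw [Finsupp.sum, Finset.card_eq_sum_ones]
      exact Finset.sum_le_sum fun i hi => Nat.one_le_iff_ne_zero.2 (Finsupp.mem_support_iff.1 hi)
    have hne : ρ v ≠ 0 := by
      intro h0; rw [h0] at hm; simp at hm
    have h2 : (ρ v * qv pred F v).totalDegree = (ρ v).totalDegree + (qv pred F v).totalDegree :=
      totalDegree_mul_of_isDomain hne (qv_ne_zero pred v)
    have h3 : (ρ v * qv pred F v).totalDegree ≤ D := by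
      rw [hD, ← polys_some pred t F v]
      exact le_trans (Finset.le_sup (f := fun i => (r i * (pebCNF N pred t).polys F i).totalDegree)
        (Finset.mem_univ (pidx pred t (some v)))) (le_max_left _ _)
    omega
  have hadj : ∀ A B, G.Adj A B → PAdj pred A B ∧ A.card ≤ D + 3 := by
    intro A B hAB
    have hmem : s(A, B) ∈ E := by
      simpa using ((SimpleGraph.fromEdgeSet_adj _).1 hAB).1
    simp only [E, Finset.mem_biUnion, Finset.mem_univ, true_and, Finset.mem_image] at hmem
    obtain ⟨v, m, hm, he⟩ := hmem
    have hd := hdegρ v m hm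
    have hp := hpred v
    have hc1 := Finset.card_union_le m.support (pred v)
    have hc2 := Finset.card_insert_le v (m.support ∪ pred v)
    have hP : PAdj pred (m.support ∪ pred v) (insert v (m.support ∪ pred v)) :=
      ⟨v, Finset.subset_union_right,
        Finset.subset_union_right.trans (Finset.subset_insert _ _), by simp⟩
    rw [Sym2.eq_iff] at he
    rcases he with ⟨rfl, rfl⟩ | ⟨rfl, rfl⟩
    · exact ⟨hP, by omega⟩
    · exact ⟨hP.symm, by omega⟩
  -- the linear functional
  let χ : (Fin N →₀ ℕ) → F := fun m => if G.Reachable ∅ m.support then 1 else 0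
  let L : MvPolynomial (Fin N) F →ₗ[F] F := (basisMonomials (Fin N) F).constr F χ
  have hL : ∀ m a, L (monomial m a) = a * χ m := by
    intro m a
    have h1 : (monomial m a : MvPolynomial (Fin N) F) = a • monomial m 1 := by
      rw [smul_monomial]; simp
    have h2 : L (monomial m 1) = χ m := (basisMonomials (Fin N) F).constr_basis F χ m
    rw [h1, map_smul, h2, smul_eq_mul]
  have hLmul : ∀ p q : MvPolynomial (Fin N) F,
      (∀ m ∈ p.support, L (monomial m 1 * q) = 0) → L (p * q) = 0 := by
    intro p q hpq
    have : p * q = ∑ m ∈ p.support, (coeff m p) • (monomial m 1 * q) := by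
      conv_lhs => rw [p.as_sum, Finset.sum_mul]
      refine Finset.sum_congr rfl fun m _ => ?_
      rw [← smul_mul_assoc, smul_monomial]; simp
    rw [this, map_sum]
    refine Finset.sum_eq_zero fun m hm => ?_
    rw [map_smul, hpq m hm, smul_zero]
  have hsupp_add : ∀ a b : Fin N →₀ ℕ, (a + b).support = a.support ∪ b.support := by
    intro a b; ext x; simp [Finsupp.mem_support_iff]; tauto
  have hsupp_sum : ∀ P : Finset (Fin N),
      (∑ u ∈ P, Finsupp.single u 1 : Fin N →₀ ℕ).support = P := by
    intro P
    induction P using Finset.induction_on with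
    | empty => simp
    | insert a P ha ih =>
      rw [Finset.sum_insert ha, hsupp_add, ih, Finsupp.support_single _ one_ne_zero]
      simp
  have hbool : ∀ j, L (s j * (X j ^ 2 - X j)) = 0 := by
    intro j
    refine hLmul _ _ fun m _ => ?_
    rw [mul_sub, map_sub, X_pow_eq_monomial, X, monomial_mul, monomial_mul, hL, hL]
    have : χ (m + Finsupp.single j 2) = χ (m + Finsupp.single j 1) := by
      simp only [χ, hsupp_add]
      rw [Finsupp.support_single _ two_ne_zero, Finsupp.support_single _ one_ne_zero]
    rw [this]; ring
  have hvert : ∀ v, L (ρ v * qv pred F v) = 0 := by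
    intro v
    refine hLmul _ _ fun m hm => ?_
    rw [qv_eq, mul_sub, map_sub, monomial_mul, monomial_mul, hL, hL]
    have e1 : (m + ∑ u ∈ pred v, Finsupp.single u 1).support = m.support ∪ pred v := by
      rw [hsupp_add, hsupp_sum]
    have e2 : (m + (∑ u ∈ pred v, Finsupp.single u 1 + Finsupp.single v 1)).support =
        insert v (m.support ∪ pred v) := by
      rw [hsupp_add, hsupp_add, hsupp_sum, Finsupp.support_single _ one_ne_zero]
      ext x; simp
    have : χ (m + ∑ u ∈ pred v, Finsupp.single u 1) =
        χ (m + (∑ u ∈ pred v, Finsupp.single u 1 + Finsupp.single v 1)) := by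
      simp only [χ, e1, e2]
      by_cases heq : m.support ∪ pred v = insert v (m.support ∪ pred v)
      · rw [← heq]
      · have hA : G.Adj (m.support ∪ pred v) (insert v (m.support ∪ pred v)) := by
          refine (SimpleGraph.fromEdgeSet_adj _).2 ⟨?_, heq⟩
          simp only [E, Finset.mem_coe, Finset.mem_biUnion, Finset.mem_univ, true_and,
            Finset.mem_image]
          exact ⟨v, m, hm, rfl⟩
        have : G.Reachable ∅ (m.support ∪ pred v) ↔
            G.Reachable ∅ (insert v (m.support ∪ pred v)) :=
          ⟨fun h => h.trans hA.reachable, fun h => h.trans hA.symm.reachable⟩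
        simp only [this]
    rw [this]; ring
  have hone : L 1 = 1 := by
    have := hL 0 1
    have h1 : (monomial 0 (1 : F) : MvPolynomial (Fin N) F) = 1 := rfl
    rw [h1] at this
    rw [this]; simp [χ]
  obtain ⟨Q, hQ, htQ⟩ : ∃ Q, G.Reachable ∅ Q ∧ t ∈ Q := by
    by_contra hcon
    push Not at hcon
    have hsink : L (r (pidx pred t none) * X t) = 0 := by
      refine hLmul _ _ fun m _ => ?_
      rw [X, monomial_mul, hL]
      have : χ (m + Finsupp.single t 1) = 0 := by
        simp only [χ]
        rw [if_neg]
        intro hr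
        refine hcon _ hr ?_
        simp
      rw [this, mul_zero]
    have hc := congrArg L ((cert_iff pred t r s).1 h)
    rw [map_add, map_add, map_sum, map_sum, hsink, hone,
      Finset.sum_eq_zero fun v _ => hvert v, Finset.sum_eq_zero fun v _ => hbool v] at hc
    simp at hc
  obtain ⟨w, hw⟩ := hQ.exists_isPath
  refine ⟨w.getVert, w.length, w.getVert_zero, by rw [w.getVert_length]; exact htQ, ?_, ?_, ?_⟩
  · intro k hk
    rcases hk.lt_or_eq with h' | h'
    · exact (hadj _ _ (w.adj_getVert_succ h')).2
    · rcases Nat.eq_zero_or_pos k with h0 | h0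
      · subst h0; simp
      · obtain ⟨d, rfl⟩ : ∃ d, k = d + 1 := ⟨k - 1, by omega⟩
        exact (hadj _ _ (w.adj_getVert_succ (i := d) (by omega)).symm).2
  · intro k hk
    exact (hadj _ _ (w.adj_getVert_succ hk)).1
  · have h1 : w.length ≤ E.card := by
      rw [← w.length_edges, ← List.toFinset_card_of_nodup hw.isTrail.edges_nodup]
      refine Finset.card_le_card fun e he => ?_
      have := w.edges_subset_edgeSet (List.mem_toFinset.1 he)
      rw [SimpleGraph.edgeSet_fromEdgeSet] at this
      exact this.1
    have h2 : E.card ≤ ∑ v, (ρ v).support.card :=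
      Finset.card_biUnion_le.trans (Finset.sum_le_sum fun v _ => Finset.card_image_le)
    have h3 : ∑ v, (ρ v).support.card ≤
        ∑ v, (ρ v).support.card * (qv pred F v).support.card := by
      refine Finset.sum_le_sum fun v _ => Nat.le_mul_of_pos_right _ (Finset.card_pos.2 ?_)
      rw [Finset.nonempty_iff_ne_empty, Ne, support_eq_empty]
      exact qv_ne_zero pred v
    rw [size_eq]
    have h4 : ∑ v, (ρ v).support.card * (qv pred F v).support.card =
      ∑ v, (r (pidx pred t (some v))).support.card * (qv pred F v).support.card := rfl
    omega

end NS

/-! ### The concrete graph -/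

theorem enc_inj {c i a j i' a' j' : ℕ} (ha : a < c) (hj : j < c) (ha' : a' < c) (hj' : j' < c)
    (h : (i * c + a) * c + j = (i' * c + a') * c + j') : i = i' ∧ a = a' ∧ j = j' := by
  have key : ∀ x y x' y' : ℕ, y < c → y' < c → x * c + y = x' * c + y' → x = x' ∧ y = y' := by
    intro x y x' y' hy hy' hxy
    have hc : 0 < c := by omega
    have h1 : (x * c + y) / c = x := by
      rw [Nat.add_comm, Nat.add_mul_div_right _ _ hc, Nat.div_eq_of_lt hy, zero_add]
    have h2 : (x' * c + y') / c = x' := by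
      rw [Nat.add_comm, Nat.add_mul_div_right _ _ hc, Nat.div_eq_of_lt hy', zero_add]
    have h3 : x = x' := by rw [← h1, ← h2, hxy]
    subst h3
    exact ⟨rfl, by omega⟩
  obtain ⟨h1, h2⟩ := key _ _ _ _ hj hj' h
  obtain ⟨h3, h4⟩ := key _ _ _ _ ha ha' h1
  exact ⟨h3, h4, h2⟩

theorem exists_graph (r c n : ℕ) (hr : 1 ≤ r) (hc : 1 ≤ c) :
    ∃ (pred : Fin (r * c * c + n) → Finset (Fin (r * c * c + n)))
      (enc : ℕ → ℕ → ℕ → Fin (r * c * c + n)),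
      (∀ v, (pred v).card ≤ 2) ∧ Layered pred enc r c := by
  classical
  have hpos : 0 < r * c * c + n := by positivity
  let enc : ℕ → ℕ → ℕ → Fin (r * c * c + n) := fun i a j =>
    ⟨((i * c + a) * c + j) % (r * c * c + n), Nat.mod_lt _ hpos⟩
  have hinj : ∀ i a j i' a' j', i < r → a < c → j < c → i' < r → a' < c → j' < c →
      enc i a j = enc i' a' j' → i = i' ∧ a = a' ∧ j = j' := by
    intro i a j i' a' j' hi ha hj hi' ha' hj' h
    have bd : ∀ i a j, i < r → a < c → j < c → (i * c + a) * c + j < r * c * c + n := by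
      intro i a j hi ha hj
      have h1 : i * c + a + 1 ≤ r * c := by
        calc i * c + a + 1 ≤ i * c + c := by omega
          _ = (i + 1) * c := by ring
          _ ≤ r * c := Nat.mul_le_mul_right _ hi
      have h2 := Nat.mul_le_mul_right c h1
      rw [Nat.add_mul, one_mul] at h2
      omega
    have h' := congrArg Fin.val h
    simp only [enc] at h'
    rw [Nat.mod_eq_of_lt (bd i a j hi ha hj), Nat.mod_eq_of_lt (bd i' a' j' hi' ha' hj')] at h'
    exact enc_inj ha hj ha' hj' h'
  let pred : Fin (r * c * c + n) → Finset (Fin (r * c * c + n)) := fun v =>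
    Finset.univ.filter fun u => ∃ i a j, i < r ∧ a < c ∧ j < c ∧ v = enc i a j ∧
      ((0 < j ∧ u = enc i a (j - 1)) ∨ (0 < i ∧ u = enc (i - 1) j (c - 1)))
  have hmem : ∀ i a j, i < r → a < c → j < c → ∀ u, u ∈ pred (enc i a j) ↔
      (0 < j ∧ u = enc i a (j - 1)) ∨ (0 < i ∧ u = enc (i - 1) j (c - 1)) := by
    intro i a j hi ha hj u
    simp only [pred, Finset.mem_filter, Finset.mem_univ, true_and]
    constructor
    · rintro ⟨i', a', j', hi', ha', hj', he, h⟩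
      obtain ⟨rfl, rfl, rfl⟩ := hinj _ _ _ _ _ _ hi ha hj hi' ha' hj' he
      exact h
    · intro h
      exact ⟨i, a, j, hi, ha, hj, rfl, h⟩
  refine ⟨pred, enc, ?_, ?_, hmem⟩
  · intro v
    by_cases hv : ∃ i a j, i < r ∧ a < c ∧ j < c ∧ v = enc i a j
    · obtain ⟨i, a, j, hi, ha, hj, rfl⟩ := hv
      have hsub : pred (enc i a j) ⊆ {enc i a (j - 1), enc (i - 1) j (c - 1)} := by
        intro u hu
        rw [hmem i a j hi ha hj] at hu
        rcases hu with ⟨_, rfl⟩ | ⟨_, rfl⟩ <;> simp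
      exact (Finset.card_le_card hsub).trans Finset.card_le_two
    · have : pred v = ∅ := by
        refine Finset.filter_eq_empty_iff.2 ?_
        rintro u _ ⟨i, a, j, hi, ha, hj, he, _⟩
        exact hv ⟨i, a, j, hi, ha, hj, he⟩
      simp [this]
  · intro i a j a' j' hi ha hj ha' hj' h
    exact (hinj _ _ _ _ _ _ hi ha hj hi ha' hj' h).2

theorem exists_two_pow (c : ℕ) (hc : 1 ≤ c) : ∃ k, c ≤ 2 ^ k ∧ 2 ^ k ≤ 2 * c := by
  induction c, hc using Nat.le_induction with
  | base => exact ⟨0, by norm_num⟩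
  | succ c hc ih =>
    obtain ⟨k, h1, h2⟩ := ih
    by_cases h : c + 1 ≤ 2 ^ k
    · exact ⟨k, h, by omega⟩
    · exact ⟨k + 1, by rw [pow_succ]; omega, by rw [pow_succ]; omega⟩

theorem exists_formula (r c n : ℕ) (hr : 1 ≤ r) (hc : 1 ≤ c) :
    ∃ φ : CNF, φ.Is3CNF ∧ φ.Unsat ∧ φ.nvars = r * c * c + n ∧
      φ.clauses.card = r * c * c + n + 1 ∧
      ∀ (F : Type) [Field F],
        (∀ k, c ≤ 2 ^ k → ∃ r' s, IsNSCert (φ.polys F) r' s ∧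
          nsDegree (φ.polys F) r' s ≤ r * (k + 2)) ∧
        (∀ k, r ≤ 2 ^ k → ∃ r' s, IsNSCert (φ.polys F) r' s ∧
          nsSize (φ.polys F) r' s ≤ 2 * (3 ^ k * (c * (2 * c))) + 1 ∧
          nsDegree (φ.polys F) r' s ≤ 3 * c + k * c) ∧
        (∀ r' s, IsNSCert (φ.polys F) r' s →
          (c / (nsDegree (φ.polys F) r' s + 4)) ^ (r - 1) ≤ nsSize (φ.polys F) r' s) := by
  obtain ⟨pred, enc, hcard, H⟩ := exists_graph r c n hr hc
  have hfast := fun k hk => fast H hc hr k hk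
  refine ⟨pebCNF _ pred (enc (r - 1) 0 (c - 1)), ?_, ?_, rfl, pebCNF_card _ _, ?_⟩
  · intro C hC
    obtain ⟨o, _, rfl⟩ := Finset.mem_image.1 hC
    cases o with
    | none => simp [pcl]
    | some v =>
      have := hcard v
      simp [pcl]; omega
  · obtain ⟨k, hk, _⟩ := exists_two_pow r hr
    obtain ⟨Q, hQ, hR⟩ := hfast k hk
    exact unsat_of_cert pred _ hR hQ
  · intro F _
    refine ⟨?_, ?_, ?_⟩
    · intro k hk
      obtain ⟨T, hT⟩ := low_space H hc k hk (r - 1) (by omega)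
      obtain ⟨r', s, h1, h2, h3⟩ := ns_upper pred _ (hT 0 hc) (Finset.mem_singleton_self _) F
      refine ⟨r', s, h1, ?_⟩
      have : r - 1 + 1 = r := by omega
      rwa [this] at h3
    · intro k hk
      obtain ⟨Q, hQ, hR⟩ := hfast k hk
      exact ns_upper pred _ hR hQ F
    · intro r' s hcert
      obtain ⟨P, T, h0, hT, hsp, hadj, hsz⟩ := ns_lower pred _ hcard r' s hcert
      have := pebbling_lower H hc _ P T hsp hadj (r - 1) (by omega) 0 hc 0 T (Nat.zero_le _) le_rfl
        (by rw [h0]; simp) hT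
      rw [zero_add] at this
      exact this.trans hsz

/-! ### Asymptotics -/

theorem le_two_logb {m n : ℕ} (hn : 1 ≤ n) (h : 2 ^ m ≤ n * n) :
    (m : ℝ) ≤ 2 * Real.logb 2 n := by
  have hn' : (0 : ℝ) < n := by exact_mod_cast hn
  have h' : (2 : ℝ) ^ (m : ℝ) ≤ (n : ℝ) ^ (2 : ℕ) := by
    rw [Real.rpow_natCast, pow_two]; exact_mod_cast h
  have h2 := (Real.le_logb_iff_rpow_le (b := 2) (by norm_num) (by positivity)).2 h'
  rw [Real.logb_pow] at h2
  exact_mod_cast h2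

theorem param_facts {n G c : ℕ} (hn : 1 ≤ n) (hG : G ≤ Nat.sqrt n)
    (hc : c = Nat.sqrt n / (G + 1) + 1) :
    (G + 1) * c ≤ 3 * Nat.sqrt n ∧ Nat.sqrt n + 1 ≤ (G + 1) * c := by
  have hQ : 1 ≤ Nat.sqrt n := Nat.sqrt_pos.2 hn
  have h1 := Nat.mul_div_le (Nat.sqrt n) (G + 1)
  have h2 := Nat.lt_mul_div_succ (Nat.sqrt n) (Nat.succ_pos G)
  subst hc
  constructor
  · rw [mul_add, mul_one]; omega
  · exact h2

theorem lower_arith (δ : ℝ) (hδ4 : δ ≤ 1 / 4) (n G c D k : ℕ) (hn : 2 ≤ n)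
    (hG : 1 ≤ G) (hG4 : (G : ℝ) ≤ (n : ℝ) ^ ((1 : ℝ) / 4))
    (hc : Nat.sqrt n + 1 ≤ (G + 1) * c)
    (hD : (D : ℝ) ≤ (n : ℝ) ^ ((1 : ℝ) / 2 - δ) / G)
    (hbig : 20 ≤ (n : ℝ) ^ (δ / 2)) (hk : (k : ℝ) + 1 ≤ δ / 2 * (G / 4 : ℕ)) :
    (n : ℝ) ^ k < (((c / (D + 4)) ^ (G / 4) : ℕ) : ℝ) := by
  have hn0 : (0 : ℝ) < n := by positivity
  have hn1 : (1 : ℝ) < n := by exact_mod_cast hn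
  have hG0 : (0 : ℝ) < G := by exact_mod_cast hG
  set y := (n : ℝ) ^ ((1 : ℝ) / 2 - δ) with hy
  set z := (n : ℝ) ^ (δ / 2) with hz
  have hy0 : 0 < y := by positivity
  have hx : Real.sqrt n = y * (z * z) := by
    rw [Real.sqrt_eq_rpow, hy, hz, ← Real.rpow_add hn0, ← Real.rpow_add hn0]
    congr 1; ring
  have hGy : (G : ℝ) ≤ y :=
    hG4.trans (Real.rpow_le_rpow_of_exponent_le hn1.le (by linarith))
  have hDG : (D : ℝ) * G ≤ y := by rwa [le_div_iff₀ hG0] at hD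
  have hcx : Real.sqrt n ≤ (G + 1) * c := by
    have h1 : Real.sqrt n ≤ (Nat.sqrt n + 1 : ℕ) := by
      rw [Real.sqrt_le_left (by positivity)]
      have := Nat.lt_succ_sqrt' n
      exact_mod_cast this.le
    have h2 : ((Nat.sqrt n + 1 : ℕ) : ℝ) ≤ ((G + 1) * c : ℕ) := by exact_mod_cast hc
    push_cast at h1 h2
    linarith
  set q := c / (D + 4) with hq
  have hcq : (c : ℝ) ≤ (q + 1) * (D + 4) := by
    have := Nat.lt_mul_div_succ c (show 0 < D + 4 by omega)
    rw [← hq, mul_comm] at this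
    exact_mod_cast this.le
  have hG1 : (1 : ℝ) ≤ G := by exact_mod_cast hG
  have hc0 : (0 : ℝ) ≤ c := by positivity
  have hq0 : (0 : ℝ) ≤ q := by positivity
  have e1 : y * (z * z) ≤ y * (10 * (q + 1)) := by
    calc y * (z * z) = Real.sqrt n := hx.symm
      _ ≤ (G + 1) * c := hcx
      _ ≤ (2 * G) * c := by gcongr; linarith
      _ ≤ (2 * G) * ((q + 1) * (D + 4)) := by gcongr
      _ = 2 * (q + 1) * (D * G + 4 * G) := by ring
      _ ≤ 2 * (q + 1) * (y + 4 * y) := by gcongr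
      _ = y * (10 * (q + 1)) := by ring
  have e2 : z * z ≤ 10 * (q + 1) := le_of_mul_le_mul_left e1 hy0
  have hzq : z ≤ q := by nlinarith
  have hz0 : 0 < z := by positivity
  push_cast
  calc (n : ℝ) ^ k < (n : ℝ) ^ (k + 1) := pow_lt_pow_right₀ hn1 (by omega)
    _ = (n : ℝ) ^ ((k : ℝ) + 1) := by
      rw [← Real.rpow_natCast]; push_cast; rfl
    _ ≤ (n : ℝ) ^ (δ / 2 * (G / 4 : ℕ)) := Real.rpow_le_rpow_of_exponent_le hn1.le hk
    _ = z ^ (G / 4) := by rw [Real.rpow_mul hn0.le, Real.rpow_natCast]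
    _ ≤ (q : ℝ) ^ (G / 4) := by gcongr

/-- For any constant `δ > 0` and any monotone nondecreasing `g : ℕ → ℕ` with
`g(n) → ∞` and `g(n) ≤ n^{1/4}`, there is a family of unsatisfiable 3-CNF formulas of size
`Θ(n)` such that, over any field: (1) there is a Nullstellensatz refutation of degree at most
`g(n) log n`; (2) for every `ε > 0` there is a refutation of size `O(n^{1+ε})` and degree
`O(n^{1/2} log n / g(n))`; (3) there is a `K > 0` such that every refutation of degree at most
`K n^{1/2-δ} / g(n)` has size superpolynomial in `n`. -/
theorem nullstellensatz_small_degree_tradeoff (δ : ℝ) (hδ : 0 < δ) (g : ℕ → ℕ)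
    (hmono : Monotone g) (hinf : Filter.Tendsto g Filter.atTop Filter.atTop)
    (hbound : ∀ n : ℕ, 1 ≤ n → (g n : ℝ) ≤ (n : ℝ) ^ ((1 : ℝ) / 4)) :
    ∃ φ : ℕ → CNF,
      (∀ n, (φ n).Is3CNF ∧ (φ n).Unsat) ∧
      (∃ a b : ℝ, 0 < a ∧ 0 < b ∧ ∀ n : ℕ, 1 ≤ n →
        a * n ≤ ((φ n).nvars : ℝ) ∧ ((φ n).nvars : ℝ) ≤ b * n ∧
        a * n ≤ ((φ n).clauses.card : ℝ) ∧ ((φ n).clauses.card : ℝ) ≤ b * n) ∧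
      ∀ (F : Type) [Field F],
        -- (1) a refutation of degree at most g(n) log n
        (∃ N : ℕ, ∀ n : ℕ, N ≤ n →
          ∃ r s, IsNSCert ((φ n).polys F) r s ∧
            (nsDegree ((φ n).polys F) r s : ℝ) ≤ (g n : ℝ) * Real.logb 2 n) ∧
        -- (2) a refutation of size O(n^{1+ε}) and degree O(n^{1/2} log n / g(n))
        (∀ ε : ℝ, 0 < ε → ∃ C : ℝ, 0 < C ∧ ∃ N : ℕ, ∀ n : ℕ, N ≤ n →
          ∃ r s, IsNSCert ((φ n).polys F) r s ∧
            (nsSize ((φ n).polys F) r s : ℝ) ≤ C * (n : ℝ) ^ ((1 : ℝ) + ε) ∧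
            (nsDegree ((φ n).polys F) r s : ℝ) ≤
              C * (n : ℝ) ^ ((1 : ℝ) / 2) * Real.logb 2 n / (g n : ℝ)) ∧
        -- (3) superpolynomial size for degree at most K n^{1/2-δ} / g(n)
        (∃ K : ℝ, 0 < K ∧ ∀ k : ℕ, ∃ N : ℕ, ∀ n : ℕ, N ≤ n →
          ∀ r s, IsNSCert ((φ n).polys F) r s →
            (nsDegree ((φ n).polys F) r s : ℝ) ≤
              K * (n : ℝ) ^ ((1 : ℝ) / 2 - δ) / (g n : ℝ) →
            (n : ℝ) ^ k < (nsSize ((φ n).polys F) r s : ℝ)) := by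
  have hGsq : ∀ n, 1 ≤ n → g n ≤ Nat.sqrt n := by
    intro n hn
    have h1 := hbound n hn
    have hn1 : (1 : ℝ) ≤ n := by exact_mod_cast hn
    have h2 : (n : ℝ) ^ ((1 : ℝ) / 4) ≤ (n : ℝ) ^ ((1 : ℝ) / 2) :=
      Real.rpow_le_rpow_of_exponent_le hn1 (by norm_num)
    rw [← Real.sqrt_eq_rpow] at h2
    have h3 := Real.le_sqrt' (x := (g n : ℝ)) (y := n)
    rw [Nat.le_sqrt']
    have h4 : (g n : ℝ) ^ 2 ≤ n := by
      have h5 := pow_le_pow_left₀ (Nat.cast_nonneg _) (h1.trans h2) 2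
      rwa [Real.sq_sqrt (by positivity)] at h5
    exact_mod_cast h4
  choose φ h3 hU hnv hcl hF using fun n : ℕ =>
    exists_formula (g n / 4 + 1) (Nat.sqrt n / (g n + 1) + 1) n (by omega) (Nat.le_add_left _ _)
  have hpar := fun n hn => param_facts (G := g n) hn (hGsq n hn) rfl
  generalize hc : (fun n => Nat.sqrt n / (g n + 1) + 1) = c at *
  have hc' : ∀ n, Nat.sqrt n / (g n + 1) + 1 = c n := fun n => by rw [← hc]
  simp only [hc'] at hnv hcl hF hpar
  have hc1 : ∀ n, 1 ≤ c n := fun n => by rw [← hc']; exact Nat.le_add_left _ _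
  have hrc : ∀ n, 1 ≤ n → (g n / 4 + 1) * c n ≤ 3 * Nat.sqrt n := fun n hn =>
    le_trans (Nat.mul_le_mul_right _ (by omega)) (hpar n hn).1
  have hc3 : ∀ n, 1 ≤ n → c n ≤ 3 * Nat.sqrt n := fun n hn =>
    le_trans (Nat.le_mul_of_pos_left _ (by omega)) (hrc n hn)
  have hr3 : ∀ n, 1 ≤ n → g n / 4 + 1 ≤ 3 * Nat.sqrt n := fun n hn =>
    le_trans (Nat.le_mul_of_pos_right _ (hc1 n)) (hrc n hn)
  have hrc2 : ∀ n, 1 ≤ n → ((g n / 4 + 1) * c n) * ((g n / 4 + 1) * c n) ≤ 9 * n := by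
    intro n hn
    have h1 := Nat.mul_le_mul (hrc n hn) (hrc n hn)
    have h2 := Nat.sqrt_le n
    nlinarith
  refine ⟨φ, fun n => ⟨h3 n, hU n⟩, ⟨1, 11, by norm_num, by norm_num, ?_⟩, ?_⟩
  · intro n hn
    have h1 : (g n / 4 + 1) * c n * c n ≤ 9 * n := by
      refine le_trans ?_ (hrc2 n hn)
      exact Nat.mul_le_mul_left _ (Nat.le_mul_of_pos_left _ (by omega))
    have e1 := hnv n
    have e2 := hcl n
    generalize (φ n).clauses.card = y at *
    generalize (φ n).nvars = x at *
    subst e1 e2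
    rw [one_mul]
    refine ⟨?_, ?_, ?_, ?_⟩
    · exact_mod_cast (by omega : n ≤ (g n / 4 + 1) * c n * c n + n)
    · exact_mod_cast (by omega : (g n / 4 + 1) * c n * c n + n ≤ 11 * n)
    · exact_mod_cast (by omega : n ≤ (g n / 4 + 1) * c n * c n + n + 1)
    · exact_mod_cast (by omega : (g n / 4 + 1) * c n * c n + n + 1 ≤ 11 * n)
  intro F _
  refine ⟨?_, ?_, ?_⟩
  · obtain ⟨N, hN⟩ := Filter.eventually_atTop.1 (hinf.eventually_ge_atTop 4)
    refine ⟨max N 24, fun n hn => ?_⟩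
    have hn24 : 24 ≤ n := le_trans (le_max_right _ _) hn
    have hg4 : 4 ≤ g n := hN n (le_trans (le_max_left _ _) hn)
    obtain ⟨k, hk1, hk2⟩ := exists_two_pow (c n) (hc1 n)
    obtain ⟨r, s, h1, h2⟩ := (hF n F).1 k hk1
    refine ⟨r, s, h1, ?_⟩
    have h4 : 2 ^ (k + 2) ≤ n * n := by
      have := hc3 n (by omega)
      have := Nat.sqrt_le_self n
      have : 24 * n ≤ n * n := Nat.mul_le_mul_right _ hn24
      rw [pow_add]; omega
    have h5 := le_two_logb (by omega) h4
    have hlog : 0 ≤ Real.logb 2 n :=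
      Real.logb_nonneg (by norm_num) (by exact_mod_cast (by omega : 1 ≤ n))
    have h6 : ((2 * (g n / 4 + 1) : ℕ) : ℝ) ≤ g n := by
      exact_mod_cast (by omega : 2 * (g n / 4 + 1) ≤ g n)
    calc (nsDegree ((φ n).polys F) r s : ℝ) ≤ (((g n / 4 + 1) * (k + 2) : ℕ) : ℝ) := by
          exact_mod_cast h2
      _ = ((g n / 4 + 1 : ℕ) : ℝ) * ((k + 2 : ℕ) : ℝ) := by push_cast; ring
      _ ≤ ((g n / 4 + 1 : ℕ) : ℝ) * (2 * Real.logb 2 n) := by gcongr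
      _ = ((2 * (g n / 4 + 1) : ℕ) : ℝ) * Real.logb 2 n := by push_cast; ring
      _ ≤ g n * Real.logb 2 n := by gcongr
  · intro ε hε
    obtain ⟨N, hN⟩ := Filter.eventually_atTop.1 (hinf.eventually_ge_atTop 1)
    refine ⟨145, by norm_num, max N 48, fun n hn => ?_⟩
    have hn48 : 48 ≤ n := le_trans (le_max_right _ _) hn
    have hg1 : 1 ≤ g n := hN n (le_trans (le_max_left _ _) hn)
    obtain ⟨k, hk1, hk2⟩ := exists_two_pow (g n / 4 + 1) (by omega)
    obtain ⟨r, s, h1, h2, h3⟩ := (hF n F).2.1 k hk1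
    refine ⟨r, s, h1, ?_, ?_⟩
    · have h4 : 3 ^ k ≤ 4 * ((g n / 4 + 1) * (g n / 4 + 1)) := by
        calc 3 ^ k ≤ 4 ^ k := Nat.pow_le_pow_left (by norm_num) k
          _ = 2 ^ k * 2 ^ k := by rw [← mul_pow]; norm_num
          _ ≤ (2 * (g n / 4 + 1)) * (2 * (g n / 4 + 1)) := Nat.mul_le_mul hk2 hk2
          _ = _ := by ring
      have h5 : nsSize ((φ n).polys F) r s ≤ 145 * n := by
        have h6 := Nat.mul_le_mul_right (c n * (2 * c n)) h4
        have h7 := hrc2 n (by omega)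
        have h8 : 4 * ((g n / 4 + 1) * (g n / 4 + 1)) * (c n * (2 * c n)) =
          8 * (((g n / 4 + 1) * c n) * ((g n / 4 + 1) * c n)) := by ring
        omega
      have hn1 : (1 : ℝ) ≤ n := by exact_mod_cast (by omega : 1 ≤ n)
      calc (nsSize ((φ n).polys F) r s : ℝ) ≤ 145 * n := by exact_mod_cast h5
        _ = 145 * (n : ℝ) ^ (1 : ℝ) := by rw [Real.rpow_one]
        _ ≤ 145 * (n : ℝ) ^ (1 + ε) := by
          gcongr
          linarith
    · have h4 : 2 ^ (k + 3) ≤ n * n := by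
        have := hr3 n (by omega)
        have := Nat.sqrt_le_self n
        have : 48 * n ≤ n * n := Nat.mul_le_mul_right _ hn48
        rw [pow_add]; omega
      have h5 := le_two_logb (by omega) h4
      have hlog : 0 ≤ Real.logb 2 n :=
        Real.logb_nonneg (by norm_num) (by exact_mod_cast (by omega : 1 ≤ n))
      have hg0 : (0 : ℝ) < g n := by exact_mod_cast hg1
      have h6 : (c n : ℝ) * g n ≤ 3 * (n : ℝ) ^ ((1 : ℝ) / 2) := by
        have h7 := (hpar n (by omega)).1
        have h8 : c n * g n ≤ 3 * Nat.sqrt n := by nlinarith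
        have h9 : (Nat.sqrt n : ℝ) ≤ (n : ℝ) ^ ((1 : ℝ) / 2) := by
          rw [← Real.sqrt_eq_rpow]; exact Real.nat_sqrt_le_real_sqrt
        have h10 : (c n : ℝ) * g n ≤ 3 * (Nat.sqrt n : ℝ) := by exact_mod_cast h8
        linarith
      rw [le_div_iff₀ hg0]
      have hx : 0 ≤ (n : ℝ) ^ ((1 : ℝ) / 2) := by positivity
      calc (nsDegree ((φ n).polys F) r s : ℝ) * g n ≤ ((3 * c n + k * c n : ℕ) : ℝ) * g n := by
            gcongr
        _ = ((k + 3 : ℕ) : ℝ) * (c n * g n) := by push_cast; ring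
        _ ≤ (2 * Real.logb 2 n) * (3 * (n : ℝ) ^ ((1 : ℝ) / 2)) := by gcongr
        _ = 6 * ((n : ℝ) ^ ((1 : ℝ) / 2) * Real.logb 2 n) := by ring
        _ ≤ 145 * ((n : ℝ) ^ ((1 : ℝ) / 2) * Real.logb 2 n) := by gcongr; norm_num
        _ = 145 * (n : ℝ) ^ ((1 : ℝ) / 2) * Real.logb 2 n := by ring
  · refine ⟨1, one_pos, fun k => ?_⟩
    set δ' := min δ (1 / 4) with hδ'
    have hδ'0 : 0 < δ' := lt_min hδ (by norm_num)
    have t1 : Filter.Tendsto (fun n : ℕ => (n : ℝ) ^ (δ' / 2)) Filter.atTop Filter.atTop :=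
      (tendsto_rpow_atTop (by positivity)).comp tendsto_natCast_atTop_atTop
    obtain ⟨M, hM⟩ := exists_nat_ge (((k : ℝ) + 1) / (δ' / 2))
    have hev := ((t1.eventually_ge_atTop 20).and
      (hinf.eventually_ge_atTop (4 * M + 1))).and (Filter.eventually_ge_atTop 2)
    obtain ⟨N, hN⟩ := Filter.eventually_atTop.1 hev
    refine ⟨N, fun n hn r s hcert hdeg => ?_⟩
    obtain ⟨⟨h20, hgM⟩, hn2⟩ := hN n hn
    have hlow := (hF n F).2.2 r s hcert
    rw [Nat.add_sub_cancel] at hlow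
    have hn1 : (1 : ℝ) ≤ n := by exact_mod_cast (by omega : 1 ≤ n)
    have hD : (nsDegree ((φ n).polys F) r s : ℝ) ≤ (n : ℝ) ^ ((1 : ℝ) / 2 - δ') / g n := by
      refine hdeg.trans ?_
      rw [one_mul]
      gcongr
      exact min_le_left _ _
    have hkM : (k : ℝ) + 1 ≤ δ' / 2 * ((g n / 4 : ℕ) : ℝ) := by
      have h1 : (M : ℝ) ≤ ((g n / 4 : ℕ) : ℝ) := by exact_mod_cast (by omega : M ≤ g n / 4)
      rw [div_le_iff₀ (by positivity)] at hM
      have := mul_le_mul_of_nonneg_right h1 (show 0 ≤ δ' / 2 by positivity)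
      linarith
    have := lower_arith δ' (min_le_right _ _) n (g n) (c n) _ k hn2 (by omega)
      (hbound n (by omega)) (hpar n (by omega)).2 hD h20 hkM
    exact this.trans_le (by exact_mod_cast hlow)
end
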